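/- arXiv:0705.4132 — 3 statements merged into one kernel-verified Lean document; each statement's English description precedes it below -/
import Mathlib

section
/- For every infinite cardinal κ there exists a commutative Noetherian integral domain R of cardinality κ whose additive group is a free abelian group (i.e., R is free as a ℤ-module). -/
theorem free_of_filtration {M : Type*} [AddCommGroup M] {I : Type*} [LinearOrder I]
    [WellFoundedLT I] (F : I → Submodule ℤ M) (hF : Monotone F) (hcov : ∀ m, ∃ i, m ∈ F i)
    (Q : I → Type*) [∀ i, AddCommGroup (Q i)] (q : ∀ i, F i →ₗ[ℤ] Q i)
    (hfree : ∀ i, Module.Free ℤ (LinearMap.range (q i)))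
    (hker : ∀ i (m : F i), q i m = 0 → (m : M) = 0 ∨ ∃ j < i, (m : M) ∈ F j)
    (hker' : ∀ i j (hji : j < i) (m : M) (hm : m ∈ F j), q i ⟨m, hF hji.le hm⟩ = 0) :
    Module.Free ℤ M := by
  classical
  have B : ∀ i, Module.Basis (Module.Free.ChooseBasisIndex ℤ (LinearMap.range (q i))) ℤ
      (LinearMap.range (q i)) := fun i => Module.Free.chooseBasis ℤ _
  have hl : ∀ i k, ∃ m : F i, q i m = (B i k : Q i) := fun i k => (B i k).2
  choose l hl using hl
  let v : (Σ i, Module.Free.ChooseBasisIndex ℤ (LinearMap.range (q i))) → M :=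
    fun s => (l s.1 s.2 : M)
  have hspan : ∀ i, ∀ m ∈ F i, m ∈ Submodule.span ℤ (Set.range v) := by
    intro i
    induction i using WellFoundedLT.induction with
    | _ i ih =>
      intro m hm
      let y : LinearMap.range (q i) := ⟨q i ⟨m, hm⟩, ⟨_, rfl⟩⟩
      let m' : F i := ((B i).repr y).sum (fun k c => c • l i k)
      have hm' : (m' : M) ∈ Submodule.span ℤ (Set.range v) := by
        simp only [m', Finsupp.sum, AddSubmonoidClass.coe_finsetSum]
        refine Submodule.sum_mem _ (fun k _ => ?_)
        exact Submodule.smul_mem _ _ (Submodule.subset_span ⟨⟨i, k⟩, rfl⟩)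
      have hq : q i m' = q i ⟨m, hm⟩ := by
        have h1 : q i m' = (((B i).repr y).sum (fun k c => c • B i k) : LinearMap.range (q i)) := by
          simp [m', Finsupp.sum, map_sum, hl]
        have h2 : ((B i).repr y).sum (fun k c => c • B i k) = y := by
          have := (B i).linearCombination_repr y
          rwa [Finsupp.linearCombination_apply] at this
        rw [h1, h2]
      have h3 : q i (⟨m, hm⟩ - m') = 0 := by rw [map_sub, hq, sub_self]
      have h4 : (m - m' : M) ∈ Submodule.span ℤ (Set.range v) := by
        rcases hker i _ h3 with h | ⟨j, hj, h⟩
        · have : (m - m' : M) = 0 := h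
          rw [this]; exact Submodule.zero_mem _
        · exact ih j hj _ h
      have := Submodule.add_mem _ h4 hm'
      simpa using this
  have hli : LinearIndependent ℤ v := by
    rw [linearIndependent_iff]
    intro c hc
    by_contra hne
    have hs : (c.support.image Sigma.fst).Nonempty := by
      simpa [Finset.nonempty_iff_ne_empty] using hne
    set i := (c.support.image Sigma.fst).max' hs with hi
    have hle : ∀ s ∈ c.support, s.1 ≤ i := fun s hs' =>
      Finset.le_max' _ _ (Finset.mem_image_of_mem _ hs')
    obtain ⟨s0, hs0, hs0i⟩ := Finset.mem_image.mp ((c.support.image Sigma.fst).max'_mem hs)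
    let w : (Σ i, Module.Free.ChooseBasisIndex ℤ (LinearMap.range (q i))) → F i := fun s =>
      if h : s.1 ≤ i then ⟨v s, hF h (l s.1 s.2).2⟩ else 0
    have hw : ∑ s ∈ c.support, c s • w s = 0 := by
      apply Subtype.ext
      simp only [AddSubmonoidClass.coe_finsetSum, ZeroMemClass.coe_zero]
      rw [← hc, Finsupp.linearCombination_apply, Finsupp.sum]
      refine Finset.sum_congr rfl (fun s hs' => ?_)
      simp [w, hle s hs']
    have hqw : ∑ s ∈ c.support, c s • q i (w s) = 0 := by
      have := congrArg (q i) hw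
      simpa [map_sum] using this
    -- c restricted to i
    let d : Module.Free.ChooseBasisIndex ℤ (LinearMap.range (q i)) →₀ ℤ :=
      c.comapDomain (fun k => ⟨i, k⟩) (by intro a _ b _ h; simpa using h)
    have hdk : ∀ k, d k = c ⟨i, k⟩ := fun k => rfl
    have hd : Finsupp.linearCombination ℤ (B i) d = 0 := by
      apply Subtype.ext
      rw [Finsupp.linearCombination_apply, Finsupp.sum]
      simp only [AddSubmonoidClass.coe_finsetSum, ZeroMemClass.coe_zero]
      rw [← hqw]
      symm
      have hinj : Function.Injective (fun k => (⟨i, k⟩ : (Σ i, Module.Free.ChooseBasisIndex ℤ (LinearMap.range (q i))))) := by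
        intro a b h; simpa using h
      rw [← Finset.sum_subset (s₁ := d.support.image (fun k => (⟨i, k⟩ : (Σ i, Module.Free.ChooseBasisIndex ℤ (LinearMap.range (q i))))))]
      · rw [Finset.sum_image (fun a _ b _ h => hinj h)]
        refine Finset.sum_congr rfl (fun k _ => ?_)
        have : w ⟨i, k⟩ = l i k := by
          simp [w, v]
        rw [this, hl]
        rw [hdk]; rfl
      · intro s hs'
        obtain ⟨k, hk, rfl⟩ := Finset.mem_image.mp hs'
        rw [Finsupp.mem_support_iff, hdk] at hk
        exact Finsupp.mem_support_iff.mpr hk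
      · intro s hs' hns
        have hlt : s.1 < i := by
          refine lt_of_le_of_ne (hle s hs') (fun h => hns ?_)
          obtain ⟨j, k⟩ := s
          subst h
          refine Finset.mem_image.mpr ⟨k, ?_, rfl⟩
          rw [Finsupp.mem_support_iff, hdk]
          exact Finsupp.mem_support_iff.mp hs'
        have : q i (w s) = 0 := by
          simp only [w, dif_pos hlt.le]
          exact hker' i s.1 hlt _ (l s.1 s.2).2
        rw [this, smul_zero]
    have hd0 := (linearIndependent_iff.mp (B i).linearIndependent) d hd
    obtain ⟨j, k⟩ := s0
    have hji : j = i := hs0i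
    subst hji
    have : d k = 0 := by rw [hd0]; rfl
    exact (Finsupp.mem_support_iff.mp hs0) this
  exact Module.Free.of_basis (Module.Basis.mk hli (fun m _ => by
    obtain ⟨i, hi⟩ := hcov m
    exact hspan i m hi))

theorem exists_functional {M : Type*} [AddCommGroup M]
    (hsep : ∀ m : M, m ≠ 0 → ∃ φ : M →ₗ[ℤ] ℤ, φ m ≠ 0) (v : ℕ → M) (n : ℕ) : ∀ (w : M),
    (∃ k : ℤ, k ≠ 0 ∧ k • w ∈ Submodule.span ℤ (v '' Set.Iio n)) ∨
    ∃ φ : M →ₗ[ℤ] ℤ, (∀ i < n, φ (v i) = 0) ∧ φ w ≠ 0 := by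
  induction n with
  | zero =>
    intro w
    by_cases hw : w = 0
    · left; exact ⟨1, one_ne_zero, by simp [hw]⟩
    · right
      obtain ⟨φ, h⟩ := hsep w hw
      exact ⟨φ, by simp, h⟩
  | succ n ih =>
    intro w
    have hmono : Submodule.span ℤ (v '' Set.Iio n) ≤ Submodule.span ℤ (v '' Set.Iio (n+1)) :=
      Submodule.span_mono (Set.image_mono (Set.Iio_subset_Iio (Nat.le_succ n)))
    have hvn : v n ∈ Submodule.span ℤ (v '' Set.Iio (n+1)) :=
      Submodule.subset_span ⟨n, by simp, rfl⟩
    rcases ih w with ⟨k, hk, hkw⟩ | ⟨φ, hφ, hφw⟩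
    · left; exact ⟨k, hk, hmono hkw⟩
    · by_cases hvz : φ (v n) = 0
      · right
        refine ⟨φ, fun i hi => ?_, hφw⟩
        rcases Nat.lt_succ_iff_lt_or_eq.mp hi with h | rfl
        · exact hφ i h
        · exact hvz
      · rcases ih (φ (v n) • w - φ w • v n) with ⟨k, hk, hkw⟩ | ⟨ψ, hψ, hψw⟩
        · left
          refine ⟨k * φ (v n), mul_ne_zero hk hvz, ?_⟩
          have := Submodule.add_mem _ (hmono hkw) (Submodule.smul_mem _ (k * φ w) hvn)
          convert this using 1
          rw [smul_sub, smul_smul, smul_smul]; abel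
        · right
          refine ⟨φ (v n) • ψ - ψ (v n) • φ, fun i hi => ?_, ?_⟩
          · rcases Nat.lt_succ_iff_lt_or_eq.mp hi with h | rfl
            · simp [hφ i h, hψ i h]
            · simp; ring
          · simp at hψw ⊢
            intro h; apply hψw; linarith

theorem free_of_countable {M : Type*} [AddCommGroup M] [Countable M]
    (hsep : ∀ m : M, m ≠ 0 → ∃ φ : M →ₗ[ℤ] ℤ, φ m ≠ 0) : Module.Free ℤ M := by
  obtain ⟨v, hv⟩ := exists_surjective_nat M
  let F : ℕ → Submodule ℤ M := fun n =>
    { carrier := {m | ∃ k : ℤ, k ≠ 0 ∧ k • m ∈ Submodule.span ℤ (v '' Set.Iio n)}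
      zero_mem' := ⟨1, one_ne_zero, by simp⟩
      add_mem' := by
        rintro a b ⟨k, hk, hka⟩ ⟨k', hk', hkb⟩
        refine ⟨k * k', mul_ne_zero hk hk', ?_⟩
        have := Submodule.add_mem _ (Submodule.smul_mem _ k' hka) (Submodule.smul_mem _ k hkb)
        convert this using 1
        simp only [smul_smul, smul_add, mul_comm]
      smul_mem' := by
        rintro c a ⟨k, hk, hka⟩
        refine ⟨k, hk, ?_⟩
        rw [smul_comm]
        exact Submodule.smul_mem _ c hka }
  have hF : Monotone F := by
    rintro a b hab m ⟨k, hk, hkm⟩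
    exact ⟨k, hk, Submodule.span_mono (Set.image_mono (Set.Iio_subset_Iio hab)) hkm⟩
  have hφ : ∀ n, ∃ φ : M →ₗ[ℤ] ℤ, (∀ i < n, φ (v i) = 0) ∧ (v n ∈ F n ∨ φ (v n) ≠ 0) := by
    intro n
    rcases exists_functional hsep v n (v n) with h | ⟨φ, h1, h2⟩
    · exact ⟨0, by simp, Or.inl h⟩
    · exact ⟨φ, h1, Or.inr h2⟩
  choose φ hφ0 hφ1 using hφ
  have hφF : ∀ n, ∀ m ∈ F n, φ n m = 0 := by
    rintro n m ⟨k, hk, hkm⟩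
    have : Submodule.span ℤ (v '' Set.Iio n) ≤ LinearMap.ker (φ n) := by
      rw [Submodule.span_le]
      rintro _ ⟨i, hi, rfl⟩
      exact hφ0 n i hi
    have h := this hkm
    rw [LinearMap.mem_ker, map_smul, smul_eq_mul] at h
    exact (mul_eq_zero.mp h).resolve_left hk
  have hstep : ∀ n, ∀ m ∈ F (n+1), φ n m = 0 → m ∈ F n := by
    rintro n m ⟨k, hk, hkm⟩ h0
    have hset : v '' Set.Iio (n+1) = insert (v n) (v '' Set.Iio n) := by
      rw [← Set.image_insert_eq]; congr 1; ext; simp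
    rw [hset, Submodule.mem_span_insert] at hkm
    obtain ⟨c, z, hz, e⟩ := hkm
    have hzF : z ∈ F n := ⟨1, one_ne_zero, by simpa using hz⟩
    have hkF : k • m ∈ F n := by
      rw [e]
      refine Submodule.add_mem _ ?_ hzF
      rcases hφ1 n with h | h
      · exact Submodule.smul_mem _ _ h
      · have := congrArg (φ n) e
        rw [map_smul, h0, map_add, hφF n z hzF, map_smul] at this
        have hc : c = 0 := by simpa [h] using this.symm
        simp [hc]
    obtain ⟨k', hk', h⟩ := hkF
    exact ⟨k' * k, mul_ne_zero hk' hk, by rwa [mul_smul]⟩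
  refine free_of_filtration (fun n => F (n+1)) (fun a b h => hF (by omega)) (fun m => ?_)
    (fun _ => ℤ) (fun n => (φ n).comp (F (n+1)).subtype) (fun i => ?_) ?_ ?_
  · obtain ⟨n, rfl⟩ := hv m
    exact ⟨n, 1, one_ne_zero, by
      rw [one_smul]; exact Submodule.subset_span ⟨n, by simp, rfl⟩⟩
  · infer_instance
  · rintro i ⟨m, hm⟩ h
    have := hstep i m hm h
    cases i with
    | zero =>
      left
      obtain ⟨k, hk, h⟩ := this
      have h : k • m = 0 := by simpa using h
      by_contra hne
      obtain ⟨ψ, hψ⟩ := hsep m hne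
      have := congrArg ψ h
      simp [hk, hψ] at this
    | succ i => right; exact ⟨i, Nat.lt_succ_self i, this⟩
  · intro i j hji m hm
    exact hφF i m (hF (by omega) hm)

open HahnSeries in
/-- Hahn series with finite support. -/
def finSub (Γ : Type*) [AddCommGroup Γ] [LinearOrder Γ] [IsOrderedAddMonoid Γ] :
    Subring (HahnSeries Γ ℚ) where
  carrier := {a | a.support.Finite}
  zero_mem' := by simp
  one_mem' := by
    refine Set.Finite.subset (Set.finite_singleton (0 : Γ)) ?_
    exact support_single_subset
  add_mem' := fun {a b} ha hb => (ha.union hb).subset (support_add_subset _ _)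
  neg_mem' := fun {a} ha => by simpa using ha
  mul_mem' := fun {a b} ha hb => (ha.add hb).subset (support_mul_subset)

/-- Hahn series with integer coefficients. -/
def intSub (Γ : Type*) [AddCommGroup Γ] [LinearOrder Γ] [IsOrderedAddMonoid Γ] :
    Subring (HahnSeries Γ ℚ) where
  carrier := {a | ∀ γ, a.coeff γ ∈ (Int.castRingHom ℚ).range}
  zero_mem' := fun γ => by rw [HahnSeries.coeff_zero]; exact Subring.zero_mem _
  one_mem' := fun γ => by
    rw [HahnSeries.coeff_one]
    split_ifs
    · exact Subring.one_mem _
    · exact Subring.zero_mem _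
  add_mem' := fun {a b} ha hb γ => by
    rw [HahnSeries.coeff_add]; exact Subring.add_mem _ (ha γ) (hb γ)
  neg_mem' := fun {a} ha γ => by
    rw [HahnSeries.coeff_neg]; exact Subring.neg_mem _ (ha γ)
  mul_mem' := fun {a b} ha hb γ => by
    rw [HahnSeries.coeff_mul]
    exact Subring.sum_mem _ (fun i _ => Subring.mul_mem _ (ha _) (hb _))

section
variable {Γ : Type*} [AddCommGroup Γ] [LinearOrder Γ] [IsOrderedAddMonoid Γ]

/-- Rational Hahn series. -/
noncomputable def ratSub (Γ : Type*) [AddCommGroup Γ] [LinearOrder Γ] [IsOrderedAddMonoid Γ] :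
    Subfield (HahnSeries Γ ℚ) := Subfield.closure (finSub Γ : Set (HahnSeries Γ ℚ))

theorem mem_ratSub {h : HahnSeries Γ ℚ} :
    h ∈ ratSub Γ ↔ ∃ a ∈ finSub Γ, ∃ b ∈ finSub Γ, a / b = h := by
  rw [ratSub, Subfield.mem_closure_iff, Subring.closure_eq]

theorem fin_le_rat {h : HahnSeries Γ ℚ} (hh : h ∈ finSub Γ) : h ∈ ratSub Γ :=
  Subfield.subset_closure hh

theorem single_mem_fin (γ : Γ) (c : ℚ) : HahnSeries.single γ c ∈ finSub Γ :=
  Set.Finite.subset (Set.finite_singleton γ) HahnSeries.support_single_subset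

/-- The ring. -/
noncomputable def theRing (Γ : Type*) [AddCommGroup Γ] [LinearOrder Γ] [IsOrderedAddMonoid Γ] :
    Subring (HahnSeries Γ ℚ) := (ratSub Γ).toSubring ⊓ intSub Γ

theorem trunc_eq {h : HahnSeries Γ ℚ} {γ δ : Γ} (hle : γ ≤ δ)
    (hs : ∀ i ∈ h.support, i < δ → i < γ) :
    HahnSeries.truncLT γ h = HahnSeries.truncLT δ h := by
  ext i
  rw [HahnSeries.coeff_truncLT, HahnSeries.coeff_truncLT]
  by_cases h1 : i < γ
  · rw [if_pos h1, if_pos (h1.trans_le hle)]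
  · rw [if_neg h1]
    split_ifs with h2
    · by_contra h3
      exact h1 (hs i (fun h4 => h3 h4.symm) h2)
    · rfl

theorem fin_eq_sum {b : HahnSeries Γ ℚ} (hb : b ∈ finSub Γ) :
    b = ∑ β ∈ Set.Finite.toFinset hb, HahnSeries.single β (b.coeff β) := by
  ext i
  rw [HahnSeries.coeff_sum]
  by_cases hi : b.coeff i = 0
  · rw [hi, Finset.sum_eq_zero]
    intro x hx
    by_cases hxi : x = i
    · subst hxi; simp [hi]
    · rw [HahnSeries.coeff_single_of_ne (Ne.symm hxi)]
  · rw [Finset.sum_eq_single i]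
    · simp
    · intro x _ hxi
      rw [HahnSeries.coeff_single_of_ne (Ne.symm hxi)]
    · intro h
      exact absurd ((Set.Finite.mem_toFinset hb).mpr hi) h

/-- Truncation of a rational series at a point of its support. -/
theorem trunc_mem_aux {h b : HahnSeries Γ ℚ} (hb : b ∈ finSub Γ) (hb0 : b.coeff 0 ≠ 0)
    (hbpos : ∀ β ∈ b.support, 0 ≤ β) (hab : b * h ∈ finSub Γ) (γ : Γ)
    (ih : ∀ γ' ≤ γ, HahnSeries.truncLT γ' h ∈ ratSub Γ ∨
      HahnSeries.truncLT γ' h = HahnSeries.truncLT γ h) :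
    HahnSeries.truncLT γ h ∈ ratSub Γ := by
  classical
  set s := Set.Finite.toFinset hb with hs
  have key : HahnSeries.truncLT γ (b * h) =
      ∑ β ∈ s, HahnSeries.single β (b.coeff β) * HahnSeries.truncLT (γ - β) h := by
    ext i
    rw [HahnSeries.coeff_truncLT, HahnSeries.coeff_sum]
    conv_lhs => rw [fin_eq_sum hb, Finset.sum_mul, HahnSeries.coeff_sum]
    simp only [HahnSeries.coeff_single_mul, HahnSeries.coeff_truncLT, sub_lt_sub_iff_right]
    split_ifs
    · rfl
    · simp
  let E := s.filter (fun β => HahnSeries.truncLT (γ - β) h = HahnSeries.truncLT γ h)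
  have hE : (∑ β ∈ E, HahnSeries.single β (b.coeff β)) * HahnSeries.truncLT γ h ∈ ratSub Γ := by
    have h1 : (∑ β ∈ E, HahnSeries.single β (b.coeff β)) * HahnSeries.truncLT γ h
        = HahnSeries.truncLT γ (b * h) - ∑ β ∈ s.filter (fun β => ¬ HahnSeries.truncLT (γ - β) h = HahnSeries.truncLT γ h), HahnSeries.single β (b.coeff β) * HahnSeries.truncLT (γ - β) h := by
      rw [key, ← Finset.sum_filter_add_sum_filter_not s
        (fun β => HahnSeries.truncLT (γ - β) h = HahnSeries.truncLT γ h), add_sub_cancel_right,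
        Finset.sum_mul]
      refine Finset.sum_congr rfl (fun β hβ => ?_)
      rw [(Finset.mem_filter.mp hβ).2]
    rw [h1]
    refine Subfield.sub_mem _ (fin_le_rat ?_) (Subfield.sum_mem _ (fun β hβ => ?_))
    · exact Set.Finite.subset hab (HahnSeries.support_truncLT_subset γ _)
    · obtain ⟨hβ1, hβ2⟩ := Finset.mem_filter.mp hβ
      refine Subfield.mul_mem _ (fin_le_rat (single_mem_fin _ _)) ?_
      refine (ih (γ - β) ?_).resolve_right hβ2
      have := hbpos β ((Set.Finite.mem_toFinset hb).mp hβ1)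
      simpa using this
  have hEne : (∑ β ∈ E, HahnSeries.single β (b.coeff β)) ≠ 0 := by
    intro h0
    have := congrArg (fun x => HahnSeries.coeff x 0) h0
    simp only [HahnSeries.coeff_sum, HahnSeries.coeff_zero] at this
    rw [Finset.sum_eq_single 0] at this
    · simp at this; exact hb0 this
    · intro x _ hx
      rw [HahnSeries.coeff_single_of_ne (Ne.symm hx)]
    · intro h
      exact absurd (Finset.mem_filter.mpr ⟨(Set.Finite.mem_toFinset hb).mpr hb0, by simp⟩) h
  have hEr : (∑ β ∈ E, HahnSeries.single β (b.coeff β)) ∈ ratSub Γ :=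
    Subfield.sum_mem _ (fun β _ => fin_le_rat (single_mem_fin _ _))
  have := Subfield.div_mem _ hE hEr
  rwa [mul_div_cancel_left₀ _ hEne] at this

theorem trunc_mem {h : HahnSeries Γ ℚ} (hh : h ∈ ratSub Γ) (γ : Γ) :
    HahnSeries.truncLT γ h ∈ ratSub Γ := by
  obtain ⟨a, ha, b, hb, hab⟩ := mem_ratSub.mp hh
  by_cases hb0 : b = 0
  · have : h = 0 := by rw [← hab, hb0, div_zero]
    rw [this, map_zero]; exact Subfield.zero_mem _
  -- normalise b
  obtain ⟨b, hb, hb0, hbpos, hbh⟩ : ∃ b ∈ finSub Γ, b.coeff 0 ≠ 0 ∧ (∀ β ∈ b.support, 0 ≤ β) ∧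
      b * h ∈ finSub Γ := by
    refine ⟨HahnSeries.single (-b.order) 1 * b, Subring.mul_mem _ (single_mem_fin _ _) hb, ?_, ?_, ?_⟩
    · rw [HahnSeries.coeff_single_mul]
      simpa using HahnSeries.coeff_order_eq_zero.not.mpr hb0
    · intro β hβ
      rw [HahnSeries.mem_support, HahnSeries.coeff_single_mul, one_mul] at hβ
      have := HahnSeries.order_le_of_coeff_ne_zero hβ
      simpa using this
    · rw [← hab, mul_assoc, mul_div_cancel₀ _ hb0]
      exact Subring.mul_mem _ (single_mem_fin _ _) ha
  -- points of the support
  have red : ∀ δ : Γ, (∀ i ∈ h.support, i < δ) ∨ ∃ μ ∈ h.support, δ ≤ μ ∧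
      (∀ i ∈ h.support, i < μ → i < δ) := by
    intro δ
    by_cases hne : (h.support ∩ Set.Ici δ).Nonempty
    · right
      have hwf : (h.support ∩ Set.Ici δ).IsWF := h.isWF_support.mono Set.inter_subset_left
      refine ⟨hwf.min hne, (hwf.min_mem hne).1, (hwf.min_mem hne).2, fun i hi hlt => ?_⟩
      by_contra hcon
      exact hwf.not_lt_min hne ⟨hi, not_lt.mp hcon⟩ hlt
    · left
      intro i hi
      by_contra hcon
      exact hne ⟨i, hi, not_lt.mp hcon⟩
  have hall : ∀ δ : Γ, (∀ i ∈ h.support, i < δ) → HahnSeries.truncLT δ h = h := by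
    intro δ hδ
    ext i
    rw [HahnSeries.coeff_truncLT]
    split_ifs with h1
    · rfl
    · by_contra h2
      exact h1 (hδ i (fun h3 => h2 h3.symm))
  have hsupp : ∀ γ ∈ h.support, HahnSeries.truncLT γ h ∈ ratSub Γ := by
    intro γ hγ
    refine h.isWF_support.induction hγ (P := fun γ => HahnSeries.truncLT γ h ∈ ratSub Γ) ?_
    intro γ hγ ih
    refine trunc_mem_aux hb hb0 hbpos hbh γ (fun γ' hγ' => ?_)
    rcases red γ' with h1 | ⟨μ, hμ, h2, h3⟩
    · left; rw [hall _ h1]; exact hh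
    · rw [trunc_eq h2 h3]
      by_cases hlt : μ < γ
      · left; exact ih μ hμ hlt
      · right
        have : μ ≤ γ := by
          by_contra hcon
          exact absurd (h3 γ hγ (not_le.mp hcon)) (not_lt.mpr hγ')
        rw [le_antisymm this (not_lt.mp hlt)]
  rcases red γ with h1 | ⟨μ, hμ, h2, h3⟩
  · rw [hall _ h1]; exact hh
  · rw [trunc_eq h2 h3]; exact hsupp μ hμ

theorem single_mem_ring (γ : Γ) (c : ℤ) : HahnSeries.single γ (c : ℚ) ∈ theRing Γ := by
  refine ⟨fin_le_rat (single_mem_fin _ _), fun i => ?_⟩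
  by_cases h : i = γ
  · subst h; exact ⟨c, by simp⟩
  · rw [HahnSeries.coeff_single_of_ne h]; exact Subring.zero_mem _

theorem ring_lc (x : HahnSeries Γ ℚ) (hx : x ∈ theRing Γ) : ∃ n : ℤ, x.leadingCoeff = n := by
  rw [HahnSeries.leadingCoeff_eq]
  obtain ⟨n, hn⟩ := hx.2 x.order
  exact ⟨n, by rw [← hn]; rfl⟩

theorem ring_pid : IsPrincipalIdealRing (theRing Γ) := by
  classical
  refine ⟨fun I => ?_⟩
  by_cases hI : I = ⊥
  · rw [hI]; exact bot_isPrincipal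
  obtain ⟨g0, hg0, hg0ne⟩ := Submodule.exists_mem_ne_zero_of_ne_bot hI
  let N : theRing Γ → ℕ := fun x => (x : HahnSeries Γ ℚ).leadingCoeff.num.natAbs
  obtain ⟨g, ⟨hg, hgne⟩, hmin⟩ : ∃ g : theRing Γ, (g ∈ I ∧ g ≠ 0) ∧
      ∀ f : theRing Γ, (f ∈ I ∧ f ≠ 0) → N g ≤ N f := by
    have hw := (measure N).wf
    refine ⟨hw.min {f | f ∈ I ∧ f ≠ 0} ⟨g0, hg0, hg0ne⟩,
      hw.min_mem {f | f ∈ I ∧ f ≠ 0} ⟨g0, hg0, hg0ne⟩, fun f hf => ?_⟩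
    exact not_lt.mp (hw.not_lt_min {f | f ∈ I ∧ f ≠ 0} hf)
  have hgne' : (g : HahnSeries Γ ℚ) ≠ 0 := fun h => hgne (Subtype.ext h)
  refine ⟨⟨g, le_antisymm (fun f hf => ?_) ?_⟩⟩
  swap
  · rw [Submodule.span_singleton_le_iff_mem]; exact hg
  set h : HahnSeries Γ ℚ := f / g with hh
  have hK : h ∈ ratSub Γ := Subfield.div_mem _ f.2.1 g.2.1
  have hgh : (g : HahnSeries Γ ℚ) * h = f := mul_div_cancel₀ _ hgne'
  by_cases hint : h ∈ intSub Γ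
  · rw [Submodule.mem_span_singleton]
    refine ⟨⟨h, hK, hint⟩, Subtype.ext ?_⟩
    change h * g = f
    rw [mul_comm, hgh]
  exfalso
  let T : Set Γ := {γ | h.coeff γ ∉ (Int.castRingHom ℚ).range}
  have hTs : T ⊆ h.support := by
    intro γ hγ h0
    apply hγ
    rw [h0]; exact Subring.zero_mem _
  have hTne : T.Nonempty := by
    by_contra hne
    apply hint
    intro γ
    by_contra hγ
    exact hne ⟨γ, hγ⟩
  have hTwf : T.IsWF := h.isWF_support.mono hTs
  set γ := hTwf.min hTne with hγ
  have hγT : γ ∈ T := hTwf.min_mem hTne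
  have hlt : ∀ i < γ, h.coeff i ∈ (Int.castRingHom ℚ).range := by
    intro i hi
    by_contra hcon
    exact hTwf.not_lt_min hTne hcon hi
  set q := HahnSeries.truncLT γ h with hq
  have hqR : q ∈ theRing Γ := by
    refine ⟨trunc_mem hK γ, fun i => ?_⟩
    rw [hq, HahnSeries.coeff_truncLT]
    split_ifs with hi
    · exact hlt i hi
    · exact Subring.zero_mem _
  set c : ℤ := ⌊h.coeff γ⌋ with hc
  set r : HahnSeries Γ ℚ := h - q - HahnSeries.single γ (c : ℚ) with hr
  have hrγ : r.coeff γ = Int.fract (h.coeff γ) := by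
    simp [hr, hq, HahnSeries.coeff_truncLT, hc]
  have hfr : 0 < Int.fract (h.coeff γ) := by
    refine lt_of_le_of_ne (Int.fract_nonneg _) (fun h0 => hγT ?_)
    refine ⟨c, ?_⟩
    have := Int.floor_add_fract (h.coeff γ)
    rw [← h0, add_zero] at this
    simpa using this
  have hr0 : r ≠ 0 := by
    intro h0
    rw [h0, HahnSeries.coeff_zero] at hrγ
    exact hfr.ne hrγ
  have hrz : ∀ i < γ, r.coeff i = 0 := by
    intro i hi
    rw [hr, HahnSeries.coeff_sub, HahnSeries.coeff_sub, HahnSeries.coeff_single_of_ne hi.ne, hq,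
      HahnSeries.coeff_truncLT_of_lt hi]
    simp
  have hro : r.order = γ := by
    refine le_antisymm (HahnSeries.order_le_of_coeff_ne_zero (by rw [hrγ]; exact hfr.ne')) ?_
    by_contra hcon
    have hcon := not_le.mp hcon
    have : r.coeff r.order ≠ 0 := HahnSeries.coeff_order_eq_zero.not.mpr hr0
    apply this
    exact hrz _ hcon
  have hrlc : r.leadingCoeff = Int.fract (h.coeff γ) := by
    rw [HahnSeries.leadingCoeff_eq, hro, hrγ]
  -- new element
  let f' : theRing Γ := f - (⟨q, hqR⟩ + ⟨_, single_mem_ring γ c⟩) * g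
  have hf'v : (f' : HahnSeries Γ ℚ) = g * r := by
    change (f : HahnSeries Γ ℚ) - (q + HahnSeries.single γ (c : ℚ)) * g = _
    rw [hr, ← hgh]; ring
  have hf'I : f' ∈ I := I.sub_mem hf (I.mul_mem_left _ hg)
  have hf'ne : f' ≠ 0 := by
    intro h0
    have : (f' : HahnSeries Γ ℚ) = 0 := by rw [h0]; rfl
    rw [hf'v] at this
    exact mul_ne_zero hgne' hr0 this
  have hle := hmin f' ⟨hf'I, hf'ne⟩
  have habs : |(f' : HahnSeries Γ ℚ).leadingCoeff| < |(g : HahnSeries Γ ℚ).leadingCoeff| := by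
    rw [hf'v, HahnSeries.leadingCoeff_mul, hrlc, abs_mul, abs_of_pos hfr]
    have : 0 < |(g : HahnSeries Γ ℚ).leadingCoeff| :=
      abs_pos.mpr (HahnSeries.leadingCoeff_ne_zero.mpr hgne')
    have h1 := Int.fract_lt_one (h.coeff γ)
    nlinarith
  obtain ⟨n, hn⟩ := ring_lc _ f'.2
  obtain ⟨m, hm⟩ := ring_lc _ g.2
  simp only [N, hn, hm, Rat.num_intCast] at hle
  rw [hn, hm] at habs
  have : |n| < |m| := by exact_mod_cast habs
  rw [Int.abs_eq_natAbs, Int.abs_eq_natAbs] at this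
  omega

end

theorem free_of_components {M ι Q : Type*} [AddCommGroup M] [AddCommGroup Q] [Nonempty ι]
    (p : ι → M →ₗ[ℤ] Q) (hfin : ∀ m, {i | p i m ≠ 0}.Finite)
    (hinj : ∀ m, (∀ i, p i m = 0) → m = 0)
    (hcount : ∀ i, (Set.range (p i)).Countable)
    (hsep : ∀ m : Q, m ≠ 0 → ∃ φ : Q →ₗ[ℤ] ℤ, φ m ≠ 0) : Module.Free ℤ M := by
  classical
  let : LinearOrder ι := linearOrderOfSTO (WellOrderingRel (α := ι))
  have : WellFoundedLT ι := ⟨(WellOrderingRel.isWellOrder (α := ι)).wf⟩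
  let F : ι → Submodule ℤ M := fun i =>
    { carrier := {m | ∀ j, i < j → p j m = 0}
      zero_mem' := fun j _ => map_zero _
      add_mem' := fun {a b} ha hb j hj => by rw [map_add, ha j hj, hb j hj, add_zero]
      smul_mem' := fun c a ha j hj => by rw [map_smul, ha j hj, smul_zero] }
  have key : ∀ m : M, m = 0 ∨ ∃ i, m ∈ F i ∧ p i m ≠ 0 := by
    intro m
    by_cases hm : m = 0
    · exact Or.inl hm
    right
    have hne : (hfin m).toFinset.Nonempty := by
      by_contra hcon
      apply hm
      apply hinj
      intro i
      by_contra hi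
      exact hcon ⟨i, (Set.Finite.mem_toFinset _).mpr hi⟩
    refine ⟨(hfin m).toFinset.max' hne, fun j hj => ?_, ?_⟩
    · by_contra hcon
      exact absurd ((hfin m).toFinset.le_max' j ((Set.Finite.mem_toFinset _).mpr hcon))
        (not_le.mpr hj)
    · exact (Set.Finite.mem_toFinset _).mp ((hfin m).toFinset.max'_mem hne)
  refine free_of_filtration F (fun a b hab m hm j hj => hm j (hab.trans_lt hj)) ?_ (fun _ => Q)
    (fun i => (p i).comp (F i).subtype) ?_ ?_ ?_
  · intro m
    rcases key m with rfl | ⟨i, hi, _⟩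
    · exact ⟨Classical.arbitrary ι, Submodule.zero_mem _⟩
    · exact ⟨i, hi⟩
  · intro i
    have : Countable (LinearMap.range ((p i).comp (F i).subtype)) := by
      refine Set.Countable.to_subtype ((hcount i).mono ?_)
      rintro _ ⟨m, rfl⟩
      exact ⟨m, rfl⟩
    refine free_of_countable (fun m hm => ?_)
    obtain ⟨φ, hφ⟩ := hsep m (fun h => hm (Subtype.ext h))
    exact ⟨φ.comp (Submodule.subtype _), hφ⟩
  · rintro i ⟨m, hm⟩ h
    rcases key m with h0 | ⟨j, hj, hj'⟩
    · exact Or.inl h0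
    · right
      refine ⟨j, ?_, hj⟩
      rcases lt_trichotomy j i with h1 | h1 | h1
      · exact h1
      · subst h1; exact absurd h hj'
      · exact absurd (hm j h1) hj'
  · intro i j hji m hm
    exact hm i hji

section
variable {X : Type*} [LinearOrder X]

/-- Integer coefficient functional. -/
noncomputable def coeffZ {Γ : Type*} [AddCommGroup Γ] [LinearOrder Γ] [IsOrderedAddMonoid Γ]
    (γ : Γ) : theRing Γ →ₗ[ℤ] ℤ :=
  AddMonoidHom.toIntLinearMap
  { toFun := fun x => ((x : HahnSeries Γ ℚ).coeff γ).num
    map_zero' := by simp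
    map_add' := by
      intro x y
      obtain ⟨a, ha⟩ := x.2.2 γ
      obtain ⟨b, hb⟩ := y.2.2 γ
      have ha : (x : HahnSeries Γ ℚ).coeff γ = a := by rw [← ha]; rfl
      have hb : (y : HahnSeries Γ ℚ).coeff γ = b := by rw [← hb]; rfl
      have : ((x + y : theRing Γ) : HahnSeries Γ ℚ).coeff γ = ((a + b : ℤ) : ℚ) := by
        push_cast
        rw [← ha, ← hb]; rfl
      rw [this, ha, hb]
      simp only [Rat.num_intCast] }

theorem coeffZ_apply {Γ : Type*} [AddCommGroup Γ] [LinearOrder Γ] [IsOrderedAddMonoid Γ]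
    (γ : Γ) (x : theRing Γ) : coeffZ γ x = ((x : HahnSeries Γ ℚ).coeff γ).num := rfl

/-- Reindexing of exponents. -/
noncomputable def embΓ {Y : Type*} [LinearOrder Y] (e : Y ↪o X) :
    Lex (Y →₀ ℤ) →+ Lex (X →₀ ℤ) where
  toFun := fun γ => toLex (Finsupp.mapDomain e (ofLex γ))
  map_zero' := by simp
  map_add' := fun a b => by simp [Finsupp.mapDomain_add]

theorem embΓ_strictMono {Y : Type*} [LinearOrder Y] (e : Y ↪o X) : StrictMono (embΓ e) := by
  intro a b hab
  obtain ⟨i, h1, h2⟩ := Finsupp.Lex.lt_iff.mp hab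
  refine Finsupp.Lex.lt_iff.mpr ⟨e i, fun j hj => ?_, ?_⟩
  · change Finsupp.mapDomain e (ofLex a) j = Finsupp.mapDomain e (ofLex b) j
    by_cases hr : j ∈ Set.range e
    · obtain ⟨k, rfl⟩ := hr
      rw [Finsupp.mapDomain_apply e.injective, Finsupp.mapDomain_apply e.injective]
      exact h1 k (e.lt_iff_lt.mp hj)
    · rw [Finsupp.mapDomain_of_notMem_range _ _ hr, Finsupp.mapDomain_of_notMem_range _ _ hr]
  · change Finsupp.mapDomain e (ofLex a) (e i) < Finsupp.mapDomain e (ofLex b) (e i)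
    rw [Finsupp.mapDomain_apply e.injective, Finsupp.mapDomain_apply e.injective]
    exact h2

/-- Reindexing of Hahn series. -/
noncomputable def embH {Y : Type*} [LinearOrder Y] (e : Y ↪o X) :
    HahnSeries (Lex (Y →₀ ℤ)) ℚ →+* HahnSeries (Lex (X →₀ ℤ)) ℚ :=
  HahnSeries.embDomainRingHom (embΓ e) (embΓ_strictMono e).injective
    (fun _ _ => (embΓ_strictMono e).le_iff_le)

theorem embH_coeff {Y : Type*} [LinearOrder Y] (e : Y ↪o X) (h : HahnSeries (Lex (Y →₀ ℤ)) ℚ)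
    (γ : Lex (Y →₀ ℤ)) : (embH e h).coeff (embΓ e γ) = h.coeff γ :=
  HahnSeries.embDomain_mk_coeff _ _

theorem embH_coeff_notMem {Y : Type*} [LinearOrder Y] (e : Y ↪o X)
    (h : HahnSeries (Lex (Y →₀ ℤ)) ℚ)
    (γ : Lex (X →₀ ℤ)) (hγ : γ ∉ Set.range (embΓ e)) : (embH e h).coeff γ = 0 :=
  HahnSeries.embDomain_of_notMem_range hγ

theorem embH_single {Y : Type*} [LinearOrder Y] (e : Y ↪o X) (γ : Lex (Y →₀ ℤ)) (c : ℚ) :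
    embH e (HahnSeries.single γ c) = HahnSeries.single (embΓ e γ) c :=
  HahnSeries.embDomain_single

theorem mem_range_embΓ {Y : Type*} [LinearOrder Y] (e : Y ↪o X) (γ : Lex (X →₀ ℤ))
    (h : ∀ x ∈ (ofLex γ).support, x ∈ Set.range e) : γ ∈ Set.range (embΓ e) := by
  refine ⟨toLex (Finsupp.comapDomain e (ofLex γ) e.injective.injOn), ?_⟩
  exact congrArg toLex (Finsupp.mapDomain_comapDomain e e.injective (ofLex γ) (fun x hx => h x hx))

theorem fin_mem_range {Y : Type*} [LinearOrder Y] (e : Y ↪o X) (a : HahnSeries (Lex (X →₀ ℤ)) ℚ)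
    (ha : a ∈ finSub (Lex (X →₀ ℤ)))
    (h : ∀ γ ∈ a.support, ∀ x ∈ (ofLex γ).support, x ∈ Set.range e) :
    ∃ a' ∈ finSub (Lex (Y →₀ ℤ)), embH e a' = a := by
  have h' : ∀ γ : Lex (X →₀ ℤ), ∃ δ, γ ∈ a.support → embΓ e δ = γ := by
    intro γ
    by_cases hγ : γ ∈ a.support
    · obtain ⟨δ, hδ⟩ := mem_range_embΓ e γ (h γ hγ)
      exact ⟨δ, fun _ => hδ⟩
    · exact ⟨0, fun h => absurd h hγ⟩
  choose d hd using h'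
  refine ⟨∑ γ ∈ Set.Finite.toFinset ha, HahnSeries.single (d γ) (a.coeff γ),
    Subring.sum_mem _ (fun _ _ => single_mem_fin _ _), ?_⟩
  rw [map_sum]
  conv_rhs => rw [fin_eq_sum ha]
  refine Finset.sum_congr rfl (fun γ hγ => ?_)
  rw [embH_single, hd γ ((Set.Finite.mem_toFinset _).mp hγ)]

theorem rat_descend (h : HahnSeries (Lex (X →₀ ℤ)) ℚ) (hh : h ∈ ratSub (Lex (X →₀ ℤ))) :
    ∃ (n : ℕ) (e : Fin n ↪o X), ∃ h' ∈ ratSub (Lex (Fin n →₀ ℤ)), embH e h' = h := by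
  classical
  obtain ⟨a, ha, b, hb, rfl⟩ := mem_ratSub.mp hh
  let W : Finset X := (Set.Finite.toFinset ha ∪ Set.Finite.toFinset hb).biUnion
    (fun γ => (ofLex γ).support)
  let e : Fin W.card ↪o X := W.orderEmbOfFin rfl
  have he : Set.range e = W := W.range_orderEmbOfFin rfl
  obtain ⟨a', ha', hea⟩ := fin_mem_range e a ha (fun γ hγ x hx => by
    rw [he]
    exact Finset.mem_biUnion.mpr
      ⟨γ, Finset.mem_union_left _ ((Set.Finite.mem_toFinset _).mpr hγ), hx⟩)
  obtain ⟨b', hb', heb⟩ := fin_mem_range e b hb (fun γ hγ x hx => by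
    rw [he]
    exact Finset.mem_biUnion.mpr
      ⟨γ, Finset.mem_union_right _ ((Set.Finite.mem_toFinset _).mpr hγ), hx⟩)
  exact ⟨W.card, e, a' / b', mem_ratSub.mpr ⟨a', ha', b', hb', rfl⟩, by
    rw [map_div₀, hea, heb]⟩

theorem countable_ratSub (Γ : Type*) [AddCommGroup Γ] [LinearOrder Γ] [IsOrderedAddMonoid Γ]
    [Countable Γ] : Countable (ratSub Γ) := by
  have hfin : Countable (finSub Γ) := by
    refine Function.Injective.countable (β := Γ →₀ ℚ)
      (f := fun a => Finsupp.ofSupportFinite a.1.coeff a.2) ?_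
    intro a b hab
    apply Subtype.ext
    ext γ
    exact DFunLike.congr_fun hab γ
  refine Function.Surjective.countable (α := finSub Γ × finSub Γ)
    (f := fun p => ⟨p.1.1 / p.2.1, mem_ratSub.mpr ⟨_, p.1.2, _, p.2.2, rfl⟩⟩) ?_
  rintro ⟨h, hh⟩
  obtain ⟨a, ha, b, hb, rfl⟩ := mem_ratSub.mp hh
  exact ⟨⟨⟨a, ha⟩, ⟨b, hb⟩⟩, rfl⟩

open Classical in
/-- Component of a series on the exponents with given set of variables. -/
noncomputable def compo (Z : Finset X) :
    theRing (Lex (X →₀ ℤ)) →ₗ[ℤ] (Lex (X →₀ ℤ) → ℤ) :=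
  LinearMap.pi (fun γ => if (ofLex γ).support = Z then coeffZ γ else 0)

theorem compo_apply_of_eq (Z : Finset X) (h : theRing (Lex (X →₀ ℤ))) (γ : Lex (X →₀ ℤ))
    (hγ : (ofLex γ).support = Z) : compo Z h γ = ((h : HahnSeries _ ℚ).coeff γ).num := by
  simp [compo, hγ, coeffZ_apply]

theorem compo_apply_of_ne (Z : Finset X) (h : theRing (Lex (X →₀ ℤ))) (γ : Lex (X →₀ ℤ))
    (hγ : (ofLex γ).support ≠ Z) : compo Z h γ = 0 := by
  simp [compo, hγ]

theorem compo_zero_of_not_subset (Z : Finset X) (h : theRing (Lex (X →₀ ℤ))) {n : ℕ}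
    (e : Fin n ↪o X) (h' : HahnSeries (Lex (Fin n →₀ ℤ)) ℚ) (he : embH e h' = h)
    (hZ : ¬ (Z : Set X) ⊆ Set.range e) : compo Z h = 0 := by
  funext γ
  by_cases hγ : (ofLex γ).support = Z
  · rw [compo_apply_of_eq _ _ _ hγ, ← he, embH_coeff_notMem]
    · rfl
    · rintro ⟨δ, rfl⟩
      apply hZ
      intro z hz
      rw [← hγ] at hz
      by_contra hcon
      exact (Finsupp.mem_support_iff.mp hz) (Finsupp.mapDomain_of_notMem_range _ _ hcon)
  · exact compo_apply_of_ne _ _ _ hγ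

theorem ring_free : Module.Free ℤ (theRing (Lex (X →₀ ℤ))) := by
  classical
  refine free_of_components (ι := Finset X) compo ?_ ?_ ?_ ?_
  · intro h
    obtain ⟨n, e, h', _, he⟩ := rat_descend h.1 h.2.1
    refine Set.Finite.subset (Finset.univ.image e).powerset.finite_toSet ?_
    intro Z hZ
    by_contra hcon
    apply hZ
    refine compo_zero_of_not_subset Z h e h' he (fun hs => hcon ?_)
    rw [Finset.mem_coe, Finset.mem_powerset]
    intro z hz
    obtain ⟨k, hk⟩ := hs hz
    exact Finset.mem_image.mpr ⟨k, Finset.mem_univ _, hk⟩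
  · intro h h0
    apply Subtype.ext
    ext γ
    have := congrFun (h0 (ofLex γ).support) γ
    rw [compo_apply_of_eq _ _ _ rfl] at this
    exact Rat.num_eq_zero.mp this
  · intro Z
    have : ∀ n : ℕ, Countable (ratSub (Lex (Fin n →₀ ℤ))) := fun n => by
      have : Countable (Lex (Fin n →₀ ℤ)) := inferInstanceAs (Countable (Fin n →₀ ℤ))
      exact countable_ratSub _
    let D := Σ n : ℕ, (ratSub (Lex (Fin n →₀ ℤ))) × (Z → Fin n)
    let G : D → (Lex (X →₀ ℤ) → ℤ) := fun d γ =>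
      if (ofLex γ).support = Z then
        (d.2.1.1.coeff (toLex (∑ z : Z, Finsupp.single (d.2.2 z) (ofLex γ z)))).num else 0
    refine ((Set.countable_singleton 0).union (Set.countable_range G)).mono ?_
    rintro _ ⟨h, rfl⟩
    obtain ⟨n, e, h', hr, he⟩ := rat_descend h.1 h.2.1
    by_cases hZ : (Z : Set X) ⊆ Set.range e
    · right
      have : ∀ z : Z, ∃ k, e k = z := fun z => hZ z.2
      choose j hj using this
      refine ⟨⟨n, ⟨h', hr⟩, j⟩, ?_⟩
      funext γ
      by_cases hγ : (ofLex γ).support = Z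
      · rw [compo_apply_of_eq _ _ _ hγ, ← he]
        simp only [G, if_pos hγ]
        rw [← embH_coeff e h']
        congr 2
        change toLex (Finsupp.mapDomain e (∑ z : Z, Finsupp.single (j z) (ofLex γ z))) = γ
        rw [Finsupp.mapDomain_finset_sum]
        simp only [Finsupp.mapDomain_single, hj]
        have h1 : ∑ z : Z, Finsupp.single (z : X) (ofLex γ z) = ofLex γ := by
          rw [Finset.sum_coe_sort Z (fun z => Finsupp.single z (ofLex γ z)), ← hγ]
          exact Finsupp.sum_single _
        rw [h1]; rfl
      · rw [compo_apply_of_ne _ _ _ hγ]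
        simp only [G, if_neg hγ]
    · left
      exact compo_zero_of_not_subset Z h e h' he hZ
  · intro m hm
    obtain ⟨γ, hγ⟩ := Function.ne_iff.mp hm
    exact ⟨LinearMap.proj γ, hγ⟩

end

universe u

theorem ring_card (X : Type u) [LinearOrder X] [Infinite X] :
    Cardinal.mk (theRing (Lex (X →₀ ℤ))) = Cardinal.mk X := by
  have hΓ : Cardinal.mk (Lex (X →₀ ℤ)) = Cardinal.mk X := by
    change Cardinal.mk (X →₀ ℤ) = _
    simp
  have hfin : Cardinal.mk (finSub (Lex (X →₀ ℤ))) ≤ Cardinal.mk X := by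
    have h1 : Cardinal.mk (Lex (X →₀ ℤ) →₀ ℚ) = Cardinal.mk X := by
      have : Infinite (Lex (X →₀ ℤ)) := by
        rw [Cardinal.infinite_iff, hΓ]; exact Cardinal.aleph0_le_mk X
      simp [hΓ]
    rw [← h1]
    refine Cardinal.mk_le_of_injective
      (f := fun a => Finsupp.ofSupportFinite a.1.coeff a.2) ?_
    intro a b hab
    apply Subtype.ext
    ext γ
    exact DFunLike.congr_fun hab γ
  apply le_antisymm
  · have h2 : ∀ h : theRing (Lex (X →₀ ℤ)), ∃ p : finSub (Lex (X →₀ ℤ)) × finSub (Lex (X →₀ ℤ)),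
        p.1.1 / p.2.1 = h.1 := by
      intro h
      obtain ⟨a, ha, b, hb, e⟩ := mem_ratSub.mp h.2.1
      exact ⟨⟨⟨a, ha⟩, ⟨b, hb⟩⟩, e⟩
    choose p hp using h2
    have hinj : Function.Injective p := fun x y hxy => Subtype.ext (by rw [← hp x, ← hp y, hxy])
    refine (Cardinal.mk_le_of_injective hinj).trans ?_
    rw [← Cardinal.mul_def]
    exact (mul_le_mul' hfin hfin).trans (Cardinal.mul_eq_self (Cardinal.aleph0_le_mk X)).le
  · refine Cardinal.mk_le_of_injective
      (f := fun x : X => (⟨_, single_mem_ring (toLex (Finsupp.single x (1 : ℤ))) 1⟩ :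
        theRing (Lex (X →₀ ℤ)))) ?_
    intro x y hxy
    have h1 := congrArg (fun h : theRing (Lex (X →₀ ℤ)) =>
      (h : HahnSeries _ ℚ).coeff (toLex (Finsupp.single x (1 : ℤ)))) hxy
    by_contra hne
    have h2 : toLex (Finsupp.single x (1 : ℤ)) ≠ toLex (Finsupp.single y (1 : ℤ)) := by
      intro h
      exact hne (Finsupp.single_left_injective one_ne_zero (toLex.injective h))
    simp [HahnSeries.coeff_single_of_ne h2] at h1

/-- For every infinite cardinal κ there exists a commutative Noetherian
integral domain R of cardinality κ whose additive group is free abelian (i.e. R is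
free as a ℤ-module). -/
theorem exists_noetherian_domain_of_cardinality_with_free_additive_group
    (κ : Cardinal.{u}) (hκ : Cardinal.aleph0 ≤ κ) :
    ∃ (R : Type u) (_ : CommRing R), IsDomain R ∧ IsNoetherianRing R ∧
      Module.Free ℤ R ∧ Cardinal.mk R = κ := by
  classical
  let : LinearOrder κ.out := linearOrderOfSTO (WellOrderingRel (α := κ.out))
  have : Infinite κ.out := by rw [Cardinal.infinite_iff, Cardinal.mk_out]; exact hκ
  have := ring_pid (Γ := Lex (κ.out →₀ ℤ))
  refine ⟨theRing (Lex (κ.out →₀ ℤ)), inferInstance, inferInstance, inferInstance, ?_, ?_⟩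
  · exact ring_free
  · rw [ring_card, Cardinal.mk_out]
end

section
/- For every set X (of arbitrary cardinality), the additive group R_X⁺ of the ring R_X is a free abelian group. -/
/-- A multivariate integer polynomial is primitive if it is not divisible by any
integer `m > 1`. -/
def MvPrimitive {X : Type*} (q : MvPolynomial X ℤ) : Prop :=
  ∀ m : ℤ, 1 < m → ¬ (MvPolynomial.C m ∣ q)

/-- `ℚ(X)`, the field of fractions of `ℤ[X]`. -/
abbrev FracField (X : Type*) := FractionRing (MvPolynomial X ℤ)

/-- The set of elements `p / q` of `ℚ(X)` with `p, q ∈ ℤ[X]` polynomials in the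
variables from `Z` and `q` primitive. -/
def Rset (X : Type*) (Z : Set X) : Set (FracField X) :=
  {x | ∃ p q : MvPolynomial X ℤ,
      p ∈ MvPolynomial.supported ℤ Z ∧ q ∈ MvPolynomial.supported ℤ Z ∧
      MvPrimitive q ∧
      x = algebraMap (MvPolynomial X ℤ) (FracField X) p /
          algebraMap (MvPolynomial X ℤ) (FracField X) q}

/-- `R_Z` as a subring of `ℚ(X)`; since the set `Rset X Z` is closed under the ring
operations (by Gauss's lemma), this subring is exactly `Rset X Z`. -/
noncomputable def Rsub (X : Type*) (Z : Set X) : Subring (FracField X) :=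
  Subring.closure (Rset X Z)

/-- `R⁺_Z`, the additive group of `R_Z`, as an additive subgroup of `ℚ(X)`;
since the set `Rset X Z` is closed under addition and negation (by Gauss's lemma),
this additive subgroup is exactly `Rset X Z`. -/
noncomputable def Radd (X : Type*) (Z : Set X) : AddSubgroup (FracField X) :=
  AddSubgroup.closure (Rset X Z)


theorem chain_free {M ι : Type*} [AddCommGroup M] [LinearOrder ι] [WellFoundedLT ι]
    (N : ι → Submodule ℤ M)
    (h : ∀ i, ∃ C : Submodule ℤ M, Module.Free ℤ C ∧ Disjoint C (⨆ j < i, N j) ∧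
      C ⊔ (⨆ j < i, N j) = N i) :
    Module.Free ℤ (⨆ i, N i : Submodule ℤ M) := by
  classical
  choose C hfree hdisj hsup using h
  have hCN : ∀ i, C i ≤ N i := fun i => (hsup i) ▸ le_sup_left
  have hind : iSupIndep C := by
    rw [iSupIndep_iff_finsetSum_eq_zero_imp_eq_zero]
    intro s
    induction s using Finset.induction_on_max with
    | empty => simp
    | insert a s hs ih =>
      intro v hv hsum
      have ha : a ∉ s := fun h => lt_irrefl _ (hs a h)
      rw [Finset.sum_insert ha] at hsum
      have h1 : v a ∈ ⨆ j < a, N j := by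
        rw [eq_neg_of_add_eq_zero_left hsum]
        refine neg_mem (sum_mem fun j hj => ?_)
        exact (le_iSup₂_of_le (f := fun j (_ : j < a) => N j) j (hs j hj) le_rfl)
          (hCN j (hv j (Finset.mem_insert_of_mem hj)))
      have h0 : v a = 0 := by
        have := (Submodule.disjoint_def.1 (hdisj a)) (v a)
          (hv a (Finset.mem_insert_self _ _)) h1
        exact this
      rw [h0, zero_add] at hsum
      intro i hi
      rcases Finset.mem_insert.1 hi with rfl | hi
      · exact h0
      · exact ih v (fun i hi => hv i (Finset.mem_insert_of_mem hi)) hsum i hi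
  have hN : ∀ i, N i ≤ ⨆ j, C j := by
    intro i
    induction i using WellFoundedLT.induction with
    | ind i ih =>
      rw [← hsup i]
      exact sup_le (le_iSup C i) (iSup₂_le ih)
  have heq : (⨆ i, N i) = ⨆ i, C i :=
    le_antisymm (iSup_le hN) (iSup_mono hCN)
  rw [heq, Submodule.iSup_eq_range_dfinsupp_lsum]
  exact Module.Free.of_equiv (LinearEquiv.ofInjective _ hind.dfinsupp_lsum_injective)

theorem exists_compl {M F : Type*} [AddCommGroup M] [AddCommGroup F]
    (N L : Submodule ℤ M) (hL : L ≤ N) (f : N →ₗ[ℤ] F) (hf : Module.Free ℤ (LinearMap.range f))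
    (hk : ∀ x : N, f x = 0 ↔ (x : M) ∈ L) :
    ∃ C : Submodule ℤ M, Module.Free ℤ C ∧ Disjoint C L ∧ C ⊔ L = N := by
  obtain ⟨g, hg⟩ := Module.projective_lifting_property f.rangeRestrict LinearMap.id
    f.surjective_rangeRestrict
  have hg' : ∀ y, f.rangeRestrict (g y) = y := fun y => by
    exact LinearMap.congr_fun hg y
  have hgi : Function.Injective (N.subtype ∘ₗ g) := by
    rw [LinearMap.coe_comp]
    exact N.injective_subtype.comp (Function.LeftInverse.injective hg')
  refine ⟨LinearMap.range (N.subtype ∘ₗ g),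
    Module.Free.of_equiv (LinearEquiv.ofInjective _ hgi), ?_, ?_⟩
  · rw [Submodule.disjoint_def]
    rintro _ ⟨y, rfl⟩ hy
    have : f (g y) = 0 := (hk _).2 hy
    have h2 : y = 0 := by
      rw [← hg' y]; ext; simpa using this
    simp [h2]
  · apply le_antisymm
    · refine sup_le ?_ hL
      rintro _ ⟨y, rfl⟩
      exact (g y).2
    · intro x hx
      rw [Submodule.mem_sup]
      refine ⟨_, ⟨f.rangeRestrict ⟨x, hx⟩, rfl⟩, x - g (f.rangeRestrict ⟨x, hx⟩), ?_, by simp⟩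
      have : f (⟨x, hx⟩ - g (f.rangeRestrict ⟨x, hx⟩)) = 0 := by
        rw [map_sub, sub_eq_zero]
        exact (congrArg Subtype.val (hg' (f.rangeRestrict ⟨x, hx⟩))).symm
      exact (hk _).1 this

theorem free_of_injective_finsupp {M ι : Type*} [AddCommGroup M]
    (Φ : M →ₗ[ℤ] (ι →₀ ℤ)) (hΦ : Function.Injective Φ) : Module.Free ℤ M := by
  obtain ⟨_, _⟩ := exists_wellFoundedLT ι
  let N : ι → Submodule ℤ M := fun i => (Finsupp.supported ℤ ℤ (Set.Iic i)).comap Φ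
  have mono : Monotone N := fun i j hij =>
    Submodule.comap_mono (Finsupp.supported_mono (Set.Iic_subset_Iic.2 hij))
  have hmem : ∀ x : M, x ≠ 0 → ∃ i, x ∈ N i ∧ i ∈ (Φ x).support := by
    intro x hx
    have hne : (Φ x).support.Nonempty := by
      rw [Finsupp.support_nonempty_iff]
      exact fun h => hx (hΦ (by simpa using h))
    exact ⟨(Φ x).support.max' hne, fun j hj => Set.mem_Iic.2 (Finset.le_max' _ _ hj),
      Finset.max'_mem _ hne⟩
  have htop : (⨆ i, N i) = ⊤ := by
    rw [eq_top_iff]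
    intro x _
    by_cases hx : x = 0
    · subst hx; exact zero_mem _
    · obtain ⟨i, hi, -⟩ := hmem x hx
      exact le_iSup N i hi
  have key : Module.Free ℤ (⨆ i, N i : Submodule ℤ M) := by
    refine chain_free N fun i => ?_
    refine exists_compl (N i) _ (iSup₂_le fun j hj => mono hj.le)
      (Finsupp.lapply i ∘ₗ Φ ∘ₗ (N i).subtype) inferInstance ?_
    rintro ⟨x, hx⟩
    constructor
    · intro h
      by_cases hx0 : x = 0
      · subst hx0; exact zero_mem _
      obtain ⟨j, hj, hj'⟩ := hmem x hx0
      have hji : j ≤ i := hx hj'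
      have : j ≠ i := by
        rintro rfl
        exact (Finsupp.mem_support_iff.1 hj') h
      exact (le_iSup₂_of_le (f := fun j (_ : j < i) => N j) j (lt_of_le_of_ne hji this) le_rfl) hj
    · intro h
      have : (⨆ j < i, N j) ≤ LinearMap.ker (Finsupp.lapply i ∘ₗ Φ) := by
        refine iSup₂_le fun j hj y hy => ?_
        by_contra hne
        have : i ≤ j := hy (Finsupp.mem_support_iff.2 hne)
        exact absurd hj (not_lt.2 this)
      exact this h
  rw [htop] at key
  exact Module.Free.of_equiv Submodule.topEquiv

theorem free_of_injective {M F : Type*} [AddCommGroup M] [AddCommGroup F] [Module.Free ℤ F]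
    (Φ : M →ₗ[ℤ] F) (hΦ : Function.Injective Φ) : Module.Free ℤ M :=
  free_of_injective_finsupp ((Module.Free.chooseBasis ℤ F).repr.toLinearMap ∘ₗ Φ)
    ((LinearEquiv.injective _).comp hΦ)

universe u

open MvPolynomial in
theorem prim_ne_zero {X : Type*} {q : MvPolynomial X ℤ} (h : MvPrimitive q) : q ≠ 0 := by
  rintro rfl
  exact h 2 (by norm_num) (dvd_zero _)

open MvPolynomial in
theorem prim_dvd {X : Type*} {b : MvPolynomial X ℤ} (hb : MvPrimitive b) (m : ℤ) (hm : m ≠ 0) :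
    ∀ P : MvPolynomial X ℤ, C m ∣ P * b → C m ∣ P := by
  have key : ∀ n : ℕ, n ≠ 0 → ∀ P : MvPolynomial X ℤ, C (n : ℤ) ∣ P * b → C (n : ℤ) ∣ P := by
    intro n
    induction n using induction_on_primes with
    | zero => intro h; exact absurd rfl h
    | one => intro _ P _; simp
    | prime_mul p a hp ih =>
      intro hn P h
      have hprime : Prime (C (p : ℤ) : MvPolynomial X ℤ) :=
        (prime_C_iff _).2 (Nat.prime_iff_prime_int.1 hp)
      have hpb : ¬ (C (p : ℤ) ∣ b) := hb p (by exact_mod_cast hp.one_lt)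
      rw [Nat.cast_mul, C_mul] at h ⊢
      obtain ⟨P', rfl⟩ := (hprime.dvd_or_dvd ((dvd_mul_right _ _).trans h)).resolve_right hpb
      rw [mul_assoc] at h
      exact mul_dvd_mul_left _ (ih (by rintro rfl; simp at hn) P'
        ((mul_dvd_mul_iff_left hprime.ne_zero).1 h))
  intro P h
  have hassoc : Associated (C ((m.natAbs : ℕ) : ℤ) : MvPolynomial X ℤ) (C m) :=
    (Int.associated_natAbs m).symm.map (C : ℤ →+* MvPolynomial X ℤ)
  rw [← hassoc.dvd_iff_dvd_left] at h ⊢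
  exact key _ (by simpa using hm) P h

open MvPolynomial in
theorem prim_mul {X : Type*} {a b : MvPolynomial X ℤ} (ha : MvPrimitive a) (hb : MvPrimitive b) :
    MvPrimitive (a * b) := fun m hm h => ha m hm (prim_dvd hb m (by omega) a h)

open MvPolynomial in
theorem prim_one {X : Type*} : MvPrimitive (1 : MvPolynomial X ℤ) := by
  intro m hm h
  rw [C_dvd_iff_dvd_coeff] at h
  have h0 : m ∣ 1 := by simpa using h 0
  have := Int.le_of_dvd (by norm_num) h0
  omega

open MvPolynomial in
theorem exists_prim {X : Type*} {q : MvPolynomial X ℤ} (hq : q ≠ 0) :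
    ∃ (d : ℤ) (q' : MvPolynomial X ℤ), d ≠ 0 ∧ q = C d * q' ∧ MvPrimitive q' := by
  set d := q.support.gcd q.coeff with hd
  have hdvd : ∀ i, d ∣ q.coeff i := by
    intro i
    by_cases hi : i ∈ q.support
    · exact Finset.gcd_dvd hi
    · rw [notMem_support_iff.1 hi]; exact dvd_zero _
  have hd0 : d ≠ 0 := by
    intro h
    apply hq
    ext i
    have := hdvd i
    rw [h, zero_dvd_iff] at this
    simpa using this
  obtain ⟨q', hq'⟩ := (C_dvd_iff_dvd_coeff d q).2 hdvd
  refine ⟨d, q', hd0, hq', fun m hm h => ?_⟩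
  have h1 : C (d * m) ∣ q := by
    rw [hq', C_mul]; exact mul_dvd_mul_left _ h
  rw [C_dvd_iff_dvd_coeff] at h1
  have h2 : d * m ∣ d * 1 := by
    rw [mul_one]
    exact Finset.dvd_gcd fun i _ => h1 i
  have := Int.le_of_dvd (by norm_num) ((mul_dvd_mul_iff_left hd0).1 h2)
  omega

open MvPolynomial in
theorem prim_rename {X X' : Type*} {j : X → X'} (hj : Function.Injective j)
    {q : MvPolynomial X ℤ} (hq : MvPrimitive q) : MvPrimitive (rename j q) := by
  intro m hm h
  refine hq m hm ?_
  have := map_dvd (killCompl hj : MvPolynomial X' ℤ →ₐ[ℤ] MvPolynomial X ℤ) h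
  rwa [killCompl_C, killCompl_rename_app] at this

open MvPolynomial in
theorem prim_of_rename {X X' : Type*} {j : X → X'}
    {q : MvPolynomial X ℤ} (hq : MvPrimitive (rename j q)) : MvPrimitive q := by
  intro m hm h
  refine hq m hm ?_
  have := map_dvd (rename j : MvPolynomial X ℤ →ₐ[ℤ] MvPolynomial X' ℤ) h
  rwa [rename_C] at this

/-- The set `Rset` as a subring. -/
noncomputable def Rring (X : Type*) (Z : Set X) : Subring (FracField X) where
  carrier := Rset X Z
  mul_mem' := by
    rintro _ _ ⟨p, q, hp, hq, h, rfl⟩ ⟨p', q', hp', hq', h', rfl⟩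
    refine ⟨p * p', q * q', mul_mem hp hp', mul_mem hq hq', prim_mul h h', ?_⟩
    rw [map_mul, map_mul, div_mul_div_comm]
  one_mem' := ⟨1, 1, one_mem _, one_mem _, prim_one, by simp⟩
  add_mem' := by
    rintro _ _ ⟨p, q, hp, hq, h, rfl⟩ ⟨p', q', hp', hq', h', rfl⟩
    refine ⟨p * q' + q * p', q * q', add_mem (mul_mem hp hq') (mul_mem hq hp'), mul_mem hq hq',
      prim_mul h h', ?_⟩
    rw [div_add_div _ _ (by simpa using prim_ne_zero h) (by simpa using prim_ne_zero h')]
    simp only [map_mul, map_add]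
  zero_mem' := ⟨0, 1, zero_mem _, one_mem _, prim_one, by simp⟩
  neg_mem' := by
    rintro _ ⟨p, q, hp, hq, h, rfl⟩
    exact ⟨-p, q, neg_mem hp, hq, h, by rw [map_neg, neg_div]⟩

/-- The additive group of `Rring` as a `ℤ`-submodule. -/
noncomputable def Rmod (X : Type*) (Z : Set X) : Submodule ℤ (FracField X) :=
  AddSubgroup.toIntSubmodule (Rring X Z).toAddSubgroup

theorem mem_Rmod {X : Type*} {Z : Set X} {x : FracField X} : x ∈ Rmod X Z ↔ x ∈ Rset X Z :=
  Iff.rfl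

theorem Rmod_mono {X : Type*} {Y Z : Set X} (h : Y ⊆ Z) : Rmod X Y ≤ Rmod X Z := by
  rintro _ ⟨p, q, hp, hq, h', rfl⟩
  exact ⟨p, q, MvPolynomial.supported_mono h hp, MvPolynomial.supported_mono h hq, h', rfl⟩

open MvPolynomial in
theorem mem_Rset_of_frac {X : Type*} {Y : Set X} {f : FracField X} (hf : f ∈ Rset X Set.univ)
    {a b : MvPolynomial X ℤ} (ha : a ∈ supported ℤ Y) (hb : b ∈ supported ℤ Y) (hb0 : b ≠ 0)
    (h : f * algebraMap (MvPolynomial X ℤ) (FracField X) b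
      = algebraMap (MvPolynomial X ℤ) (FracField X) a) : f ∈ Rset X Y := by
  have inj := IsFractionRing.injective (MvPolynomial X ℤ) (FracField X)
  by_cases ha0 : a = 0
  · subst ha0
    rw [map_zero, mul_eq_zero] at h
    have : f = 0 := h.resolve_right (by simpa using hb0)
    rw [this]
    exact (Rring X Y).zero_mem
  obtain ⟨d, a', hd, rfl, ha'⟩ := exists_prim ha0
  obtain ⟨c, b', hc, rfl, hb'⟩ := exists_prim hb0
  obtain ⟨P, Q, -, -, hQ, rfl⟩ := hf
  have hQ0 : algebraMap (MvPolynomial X ℤ) (FracField X) Q ≠ 0 := by simpa using prim_ne_zero hQ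
  have e : P * (C c * b') = C d * a' * Q := by
    apply inj
    rw [map_mul, map_mul _ (C d * a'), ← h]
    field_simp
  have h1 : C c ∣ C d * a' * Q := ⟨P * b', by rw [← e]; ring⟩
  have h2 := prim_dvd ha' c hc _ (prim_dvd hQ c hc _ h1)
  obtain ⟨k, rfl⟩ : c ∣ d := by
    rw [C_dvd_iff_dvd_coeff] at h2
    have := h2 0
    classical
    rwa [coeff_C, if_pos rfl] at this
  have hk : k ≠ 0 := by rintro rfl; simp at hd
  rw [mem_supported, vars_C_mul _ hd] at ha
  rw [mem_supported, vars_C_mul _ hc] at hb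
  refine ⟨C k * a', b', ?_, mem_supported.2 hb, hb', ?_⟩
  · rw [mem_supported, vars_C_mul _ hk]; exact ha
  · have hb0' : algebraMap (MvPolynomial X ℤ) (FracField X) b' ≠ 0 := by
      simpa using prim_ne_zero hb'
    rw [div_eq_div_iff hQ0 hb0', ← map_mul, ← map_mul]
    congr 1
    have hc' : (C c : MvPolynomial X ℤ) ≠ 0 := by simpa using hc
    apply mul_left_cancel₀ hc'
    rw [C_mul] at e
    linear_combination e

/-- The map of fraction fields induced by an injection of variables. -/
noncomputable def fmap {X X' : Type*} (j : X → X') (hj : Function.Injective j) :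
    FracField X →+* FracField X' :=
  IsFractionRing.map (K := FracField X) (L := FracField X')
    (j := (MvPolynomial.rename j : MvPolynomial X ℤ →ₐ[ℤ] MvPolynomial X' ℤ).toRingHom)
    (MvPolynomial.rename_injective j hj)

theorem fmap_algebraMap {X X' : Type*} (j : X → X') (hj : Function.Injective j)
    (p : MvPolynomial X ℤ) :
    fmap j hj (algebraMap (MvPolynomial X ℤ) (FracField X) p) =
      algebraMap (MvPolynomial X' ℤ) (FracField X') (MvPolynomial.rename j p) := by
  unfold fmap IsFractionRing.map
  rw [IsLocalization.map_eq]
  rfl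

theorem fmap_mem {X X' : Type*} (j : X → X') (hj : Function.Injective j) {Z : Set X} {Z' : Set X'}
    (hZ : ∀ z ∈ Z, j z ∈ Z') {f : FracField X} (hf : f ∈ Rset X Z) : fmap j hj f ∈ Rset X' Z' := by
  classical
  obtain ⟨p, q, hp, hq, h, rfl⟩ := hf
  have hs : ∀ p ∈ MvPolynomial.supported ℤ Z, MvPolynomial.rename j p ∈
      MvPolynomial.supported ℤ Z' := by
    intro p hp
    rw [MvPolynomial.mem_supported] at hp ⊢
    intro x hx
    have := MvPolynomial.vars_rename j p hx
    obtain ⟨y, hy, rfl⟩ := Finset.mem_image.1 this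
    exact hZ y (hp hy)
  exact ⟨_, _, hs p hp, hs q hq, prim_rename hj h, by
    rw [map_div₀, fmap_algebraMap, fmap_algebraMap]⟩

/-- If the group for the type of variables `V` is free, so is `Rmod X V`. -/
theorem free_Rmod_of_subtype {X : Type*} (V : Set X)
    (h : Module.Free ℤ (Rmod V Set.univ)) : Module.Free ℤ (Rmod X V) := by
  have hinj : Function.Injective (fmap (Subtype.val : V → X) Subtype.val_injective) :=
    RingHom.injective _
  let φ : FracField V →ₗ[ℤ] FracField X :=
    (fmap (Subtype.val : V → X) Subtype.val_injective).toAddMonoidHom.toIntLinearMap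
  have hφ : Function.Injective φ := hinj
  have hle : Rmod X V ≤ (Rmod V Set.univ).map φ := by
    rintro _ ⟨p, q, hp, hq, hprim, rfl⟩
    rw [MvPolynomial.supported_eq_range_rename] at hp hq
    obtain ⟨p, rfl⟩ := hp
    obtain ⟨q, rfl⟩ := hq
    refine ⟨algebraMap _ _ p / algebraMap _ _ q,
      ⟨p, q, by simp, by simp, prim_of_rename hprim, rfl⟩, ?_⟩
    change fmap Subtype.val Subtype.val_injective _ = _
    rw [map_div₀, fmap_algebraMap, fmap_algebraMap]
    rfl
  have : Module.Free ℤ ((Rmod V Set.univ).map φ) :=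
    Module.Free.of_equiv (Submodule.equivMapOfInjective φ hφ _)
  exact free_of_injective (Submodule.inclusion hle) (Submodule.inclusion_injective hle)


open Classical in
/-- The injection of variables fixing `Y` and moving the others to the second copy. -/
noncomputable def shiftVar {X : Type*} (Y : Set X) : X → X ⊕ X :=
  fun x => if x ∈ Y then Sum.inl x else Sum.inr x

theorem shiftVar_injective {X : Type*} (Y : Set X) : Function.Injective (shiftVar Y) := by
  intro a b h
  unfold shiftVar at h
  split_ifs at h <;> simpa using h

open MvPolynomial in
theorem mem_of_shift_eq {X : Type*} {Y : Set X} {f : FracField X} (hf : f ∈ Rset X Set.univ)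
    (h : fmap Sum.inl Sum.inl_injective f = fmap (shiftVar Y) (shiftVar_injective Y) f) :
    f ∈ Rset X Y := by
  have hf' := hf
  obtain ⟨p, q, -, -, hq, rfl⟩ := hf
  have hq0 := prim_ne_zero hq
  obtain ⟨c, hc⟩ : ∃ c : X → ℤ, eval c q ≠ 0 := by
    by_contra hcon
    push Not at hcon
    exact hq0 (MvPolynomial.funext (by simpa using hcon))
  rw [map_div₀, map_div₀, fmap_algebraMap, fmap_algebraMap, fmap_algebraMap, fmap_algebraMap] at h
  have hne : ∀ (j : X → X ⊕ X), Function.Injective j →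
      algebraMap (MvPolynomial (X ⊕ X) ℤ) (FracField (X ⊕ X)) (rename j q) ≠ 0 := by
    intro j hj
    simpa using prim_ne_zero (prim_rename hj hq)
  rw [div_eq_div_iff (hne _ Sum.inl_injective) (hne _ (shiftVar_injective Y)), ← map_mul,
    ← map_mul] at h
  have h1 := IsFractionRing.injective _ _ h
  let ε : MvPolynomial (X ⊕ X) ℤ →ₐ[ℤ] MvPolynomial X ℤ :=
    aeval (Sum.elim (fun x => MvPolynomial.X x) (fun x => C (c x)))
  have e1 : ∀ r : MvPolynomial X ℤ, ε (rename Sum.inl r) = r := by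
    intro r
    simp only [ε, aeval_rename]
    exact aeval_X_left_apply r
  have e2 : ∀ r : MvPolynomial X ℤ, ε (rename (shiftVar Y) r) ∈ supported ℤ Y := by
    intro r
    simp only [ε, aeval_rename]
    have : (aeval (Sum.elim (fun x => MvPolynomial.X x) (fun x => C (c x)) ∘ shiftVar Y) :
        MvPolynomial X ℤ →ₐ[ℤ] MvPolynomial X ℤ).range ≤ supported ℤ Y := by
      rw [← Algebra.adjoin_range_eq_range_aeval, Algebra.adjoin_le_iff]
      rintro _ ⟨x, rfl⟩
      by_cases hx : x ∈ Y
      · simpa [shiftVar, hx] using hx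
      · simpa [shiftVar, hx] using (supported ℤ Y).algebraMap_mem (c x)
    exact this ⟨r, rfl⟩
  have e3 : ε (rename (shiftVar Y) q) ≠ 0 := by
    intro h0
    apply hc
    have : (aeval c : MvPolynomial X ℤ →ₐ[ℤ] ℤ) (ε (rename (shiftVar Y) q)) = 0 := by
      rw [h0, map_zero]
    simp only [ε, aeval_rename, comp_aeval_apply] at this
    rw [← this, ← coe_aeval_eq_eval]
    change aeval c q = _
    congr 2
    funext x
    by_cases hx : x ∈ Y <;> simp [shiftVar, hx]
  have h2 := congrArg ε h1
  rw [map_mul, map_mul, e1, e1] at h2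
  refine mem_Rset_of_frac hf' (e2 p) (e2 q) e3 ?_
  have hq0' : algebraMap (MvPolynomial X ℤ) (FracField X) q ≠ 0 := by simpa using hq0
  rw [div_mul_eq_mul_div, div_eq_iff hq0', ← map_mul, ← map_mul, h2]

theorem fmap_congr {X X' : Type*} (j k : X → X') (hj : Function.Injective j)
    (hk : Function.Injective k) {Y : Set X} (hjk : ∀ y ∈ Y, j y = k y) {f : FracField X}
    (hf : f ∈ Rset X Y) : fmap j hj f = fmap k hk f := by
  obtain ⟨p, q, hp, hq, -, rfl⟩ := hf
  have : ∀ p ∈ MvPolynomial.supported ℤ Y, MvPolynomial.rename j p = MvPolynomial.rename k p := by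
    intro p hp
    rw [MvPolynomial.supported_eq_range_rename] at hp
    obtain ⟨p, rfl⟩ := hp
    change MvPolynomial.rename j (MvPolynomial.rename _ p) =
      MvPolynomial.rename k (MvPolynomial.rename _ p)
    rw [MvPolynomial.rename_rename, MvPolynomial.rename_rename]
    congr 2
    funext y
    exact hjk y y.2
  rw [map_div₀, map_div₀, fmap_algebraMap, fmap_algebraMap, fmap_algebraMap, fmap_algebraMap,
    this p hp, this q hq]

theorem exists_mem_Iic {X : Type*} [LinearOrder X] {S : Set X} (hS : S.Nonempty)
    {f : FracField X} (hf : f ∈ Rset X S) : ∃ y ∈ S, f ∈ Rset X (Set.Iic y) := by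
  classical
  obtain ⟨s, hs⟩ := hS
  obtain ⟨p, q, hp, hq, h, rfl⟩ := hf
  rw [MvPolynomial.mem_supported] at hp hq
  let T : Finset X := insert s (p.vars ∪ q.vars)
  have hT : T.Nonempty := ⟨s, by simp [T]⟩
  refine ⟨T.max' hT, ?_, p, q, ?_, ?_, h, rfl⟩
  · have := T.max'_mem hT
    simp only [T, Finset.mem_insert, Finset.mem_union] at this
    rcases this with h | h | h
    · simp only [T, h]; exact hs
    · exact hp h
    · exact hq h
  · rw [MvPolynomial.mem_supported]
    intro x hx
    exact Finset.le_max' _ _ (by simp only [T, Finset.mem_insert, Finset.mem_union]; exact .inr (.inl hx))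
  · rw [MvPolynomial.mem_supported]
    intro x hx
    exact Finset.le_max' _ _ (by simp only [T, Finset.mem_insert, Finset.mem_union]; exact .inr (.inr hx))

theorem free_step {X : Type u} [LinearOrder X] [WellFoundedLT X]
    (hX : Cardinal.aleph0 ≤ Cardinal.mk X) (hlt : ∀ x : X, Cardinal.mk (Set.Iic x) < Cardinal.mk X)
    (ih : ∀ Y : Type u, Cardinal.mk Y < Cardinal.mk X → Module.Free ℤ (Rmod Y Set.univ)) :
    Module.Free ℤ (Rmod X Set.univ) := by
  have hne : Nonempty X := by
    rw [← Cardinal.mk_ne_zero_iff]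
    intro h
    rw [h] at hX
    exact absurd hX (not_le.2 Cardinal.aleph0_pos)
  have htop : Rmod X Set.univ = ⨆ x, Rmod X (Set.Iic x) := by
    apply le_antisymm
    · intro f hf
      obtain ⟨y, -, hy⟩ := exists_mem_Iic Set.univ_nonempty hf
      exact le_iSup (fun x => Rmod X (Set.Iic x)) y hy
    · exact iSup_le fun x => Rmod_mono (Set.subset_univ _)
  rw [htop]
  refine chain_free _ fun x => ?_
  by_cases hx : (Set.Iio x).Nonempty
  · have hL : (⨆ j < x, Rmod X (Set.Iic j)) = Rmod X (Set.Iio x) := by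
      apply le_antisymm
      · exact iSup₂_le fun j hj => Rmod_mono fun y hy => lt_of_le_of_lt hy hj
      · intro f hf
        obtain ⟨y, hy, hy'⟩ := exists_mem_Iic hx hf
        exact (le_iSup₂_of_le (f := fun j (_ : j < x) => Rmod X (Set.Iic j)) y hy le_rfl) hy'
    rw [hL]
    let φ : FracField X →ₗ[ℤ] FracField (X ⊕ X) :=
      (fmap Sum.inl Sum.inl_injective).toAddMonoidHom.toIntLinearMap -
      (fmap (shiftVar (Set.Iio x)) (shiftVar_injective _)).toAddMonoidHom.toIntLinearMap
    have hφ : ∀ f, φ f = fmap Sum.inl Sum.inl_injective f -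
      fmap (shiftVar (Set.Iio x)) (shiftVar_injective _) f := fun f => rfl
    let V : Set (X ⊕ X) := Sum.inl '' Set.Iic x ∪ Sum.inr '' Set.Iic x
    have hV : Cardinal.mk V < Cardinal.mk X := by
      refine lt_of_le_of_lt (Cardinal.mk_union_le _ _) (Cardinal.add_lt_of_lt hX ?_ ?_)
      · exact lt_of_le_of_lt Cardinal.mk_image_le (hlt x)
      · exact lt_of_le_of_lt Cardinal.mk_image_le (hlt x)
    have hfree : Module.Free ℤ (Rmod (X ⊕ X) V) := free_Rmod_of_subtype V (ih _ hV)
    have hrange : LinearMap.range (φ ∘ₗ (Rmod X (Set.Iic x)).subtype) ≤ Rmod (X ⊕ X) V := by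
      rintro _ ⟨⟨f, hf⟩, rfl⟩
      change φ f ∈ _
      rw [hφ]
      refine sub_mem (fmap_mem _ _ (fun z hz => ?_) hf) (fmap_mem _ _ (fun z hz => ?_) hf)
      · exact Or.inl ⟨z, hz, rfl⟩
      · by_cases hz' : z < x
        · exact Or.inl ⟨z, hz, by simp [shiftVar, hz']⟩
        · exact Or.inr ⟨z, hz, by simp [shiftVar, hz']⟩
    refine exists_compl _ _ (Rmod_mono Set.Iio_subset_Iic_self)
      (φ ∘ₗ (Rmod X (Set.Iic x)).subtype)
      (free_of_injective (Submodule.inclusion hrange) (Submodule.inclusion_injective hrange)) ?_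
    rintro ⟨f, hf⟩
    change φ f = 0 ↔ f ∈ Rset X (Set.Iio x)
    rw [hφ, sub_eq_zero]
    constructor
    · exact mem_of_shift_eq (Rmod_mono (Set.subset_univ _) hf)
    · intro h
      exact fmap_congr _ _ _ _ (fun y hy => by
        have hy' : y < x := hy
        simp [shiftVar, hy']) h
  · have hL : (⨆ j < x, Rmod X (Set.Iic j)) = ⊥ := by
      rw [eq_bot_iff]
      exact iSup₂_le fun j hj => absurd ⟨j, hj⟩ hx
    rw [hL]
    exact ⟨_, free_Rmod_of_subtype _ (ih _ (hlt x)), disjoint_bot_right, sup_bot_eq _⟩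

open MvPolynomial in
theorem common_denom {X : Type*} (g : ℕ → FracField X) (hg : ∀ n, g n ∈ Rset X Set.univ) (n : ℕ) :
    ∃ Q : MvPolynomial X ℤ, MvPrimitive Q ∧ ∀ j < n, ∃ P : MvPolynomial X ℤ,
      g j * algebraMap _ _ Q = algebraMap (MvPolynomial X ℤ) (FracField X) P := by
  induction n with
  | zero => exact ⟨1, prim_one, fun j hj => absurd hj (Nat.not_lt_zero _)⟩
  | succ n ih =>
    obtain ⟨Q, hQ, h⟩ := ih
    obtain ⟨p, q, -, -, hq, e⟩ := hg n
    refine ⟨Q * q, prim_mul hQ hq, fun j hj => ?_⟩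
    rcases Nat.lt_succ_iff_lt_or_eq.1 hj with hj | rfl
    · obtain ⟨P, hP⟩ := h j hj
      exact ⟨P * q, by rw [map_mul, map_mul, ← hP, mul_assoc]⟩
    · refine ⟨Q * p, ?_⟩
      have hq0' : algebraMap (MvPolynomial X ℤ) (FracField X) q ≠ 0 := by
        simpa using prim_ne_zero hq
      rw [e, map_mul, map_mul]
      field_simp

theorem cast_mul_mem {X : Type*} (N : Submodule ℤ (FracField X)) (m : ℤ) {x : FracField X}
    (h : x ∈ N) : (m : FracField X) * x ∈ N := by
  rw [← zsmul_eq_mul]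
  exact zsmul_mem h m

/-- The saturation in `R_X` of the subgroup generated by the first `n` terms of a sequence. -/
noncomputable def satur {X : Type*} (g : ℕ → FracField X) (n : ℕ) :
    Submodule ℤ (FracField X) where
  carrier := {f | f ∈ Rmod X Set.univ ∧
    ∃ m : ℤ, m ≠ 0 ∧ (m : FracField X) * f ∈ Submodule.span ℤ (g '' Set.Iio n)}
  zero_mem' := ⟨zero_mem _, 1, one_ne_zero, by simp⟩
  add_mem' := by
    rintro a b ⟨ha, m, hm, h⟩ ⟨hb, k, hk, h'⟩
    refine ⟨add_mem ha hb, m * k, mul_ne_zero hm hk, ?_⟩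
    have : ((m * k : ℤ) : FracField X) * (a + b) = k * (m * a) + m * (k * b) := by
      push_cast
      ring
    rw [this]
    exact add_mem (cast_mul_mem _ _ h) (cast_mul_mem _ _ h')
  smul_mem' := by
    rintro c a ⟨ha, m, hm, h⟩
    refine ⟨Submodule.smul_mem _ _ ha, m, hm, ?_⟩
    rw [zsmul_eq_mul, mul_left_comm]
    exact cast_mul_mem _ _ h

theorem satur_mono {X : Type*} (g : ℕ → FracField X) : Monotone (satur g) := by
  rintro a b hab f ⟨hf, m, hm, h⟩
  exact ⟨hf, m, hm, Submodule.span_mono (Set.image_mono (Set.Iio_subset_Iio hab)) h⟩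

open MvPolynomial in
theorem satur_finite {X : Type*} (g : ℕ → FracField X) (hg : ∀ n, g n ∈ Rset X Set.univ) (n : ℕ) :
    Module.Finite ℤ (satur g n) := by
  classical
  obtain ⟨Q, hQ, hP⟩ := common_denom g hg n
  choose! P hP using hP
  let S : Finset (X →₀ ℕ) := (Finset.range n).biUnion fun j => (P j).support
  have hfin : Module.Finite ℤ (restrictSupport ℤ (S : Set (X →₀ ℕ))) :=
    Module.Finite.of_basis (basisRestrictSupport ℤ (S : Set (X →₀ ℕ)))
  let α : MvPolynomial X ℤ →ₗ[ℤ] FracField X :=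
    (algebraMap (MvPolynomial X ℤ) (FracField X)).toAddMonoidHom.toIntLinearMap
  let W : Submodule ℤ (FracField X) := (restrictSupport ℤ (S : Set (X →₀ ℕ))).map α
  have hW : Module.Finite ℤ W := Module.Finite.map _ _
  let μ : FracField X →ₗ[ℤ] FracField X :=
    (AddMonoidHom.mulRight (algebraMap (MvPolynomial X ℤ) (FracField X) Q)).toIntLinearMap
  have hμ : ∀ f, μ f = f * algebraMap (MvPolynomial X ℤ) (FracField X) Q := fun f => rfl
  have hQ0 : algebraMap (MvPolynomial X ℤ) (FracField X) Q ≠ 0 := by simpa using prim_ne_zero hQ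
  have hspan : Submodule.span ℤ (g '' Set.Iio n) ≤ W.comap μ := by
    rw [Submodule.span_le]
    rintro _ ⟨j, hj, rfl⟩
    refine ⟨P j, ?_, (hP j hj).symm⟩
    rw [SetLike.mem_coe, mem_restrictSupport_iff]
    intro x hx
    exact Finset.mem_coe.2 (Finset.mem_biUnion.2 ⟨j, Finset.mem_range.2 hj, hx⟩)
  have hle : ∀ f ∈ satur g n, μ f ∈ W := by
    rintro f ⟨⟨a, b, -, -, hb, rfl⟩, m, hm, h⟩
    obtain ⟨T, hT, e⟩ := hspan h
    have hb0 : algebraMap (MvPolynomial X ℤ) (FracField X) b ≠ 0 := by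
      simpa using prim_ne_zero hb
    have e' : algebraMap (MvPolynomial X ℤ) (FracField X) T =
        m * (algebraMap _ _ a / algebraMap _ _ b) * algebraMap _ _ Q := e
    have e2 : T * b = C m * (a * Q) := by
      apply IsFractionRing.injective (MvPolynomial X ℤ) (FracField X)
      rw [← smul_eq_C_mul, map_zsmul, map_mul, map_mul, e', zsmul_eq_mul]
      field_simp
    obtain ⟨T', rfl⟩ := prim_dvd hb m hm T ⟨a * Q, e2⟩
    have hm' : (C m : MvPolynomial X ℤ) ≠ 0 := by simpa using hm
    rw [mul_assoc] at e2
    have e3 := mul_left_cancel₀ hm' e2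
    refine ⟨T', ?_, ?_⟩
    · rw [SetLike.mem_coe, mem_restrictSupport_iff] at hT ⊢
      intro x hx
      apply hT
      rw [Finset.mem_coe, mem_support_iff] at hx ⊢
      rw [coeff_C_mul]
      exact mul_ne_zero hm hx
    · change algebraMap (MvPolynomial X ℤ) (FracField X) T' = _
      rw [hμ, div_mul_eq_mul_div, eq_div_iff hb0, ← map_mul, ← map_mul, e3]
  refine Module.Finite.of_injective (μ.restrict hle) ?_
  intro x y hxy
  have h1 : μ x = μ y := congrArg Subtype.val hxy
  rw [hμ, hμ] at h1
  exact Subtype.ext (mul_right_cancel₀ hQ0 h1)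

theorem free_countable {X : Type*} [Countable X] : Module.Free ℤ (Rmod X Set.univ) := by
  have hc0 : Countable (MvPolynomial X ℤ) := by
    rw [← Cardinal.mk_le_aleph0_iff]
    refine MvPolynomial.cardinalMk_le_max_lift.trans ?_
    simp
  have hc : (Rset X Set.univ).Countable := by
    refine (Set.countable_range (fun z : MvPolynomial X ℤ × MvPolynomial X ℤ =>
      algebraMap (MvPolynomial X ℤ) (FracField X) z.1 /
        algebraMap (MvPolynomial X ℤ) (FracField X) z.2)).mono ?_
    rintro _ ⟨p, q, -, -, -, rfl⟩
    exact ⟨(p, q), rfl⟩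
  obtain ⟨g, hg⟩ := hc.exists_eq_range ⟨0, (Rmod X Set.univ).zero_mem⟩
  have hgm : ∀ n, g n ∈ Rset X Set.univ := fun n => by rw [hg]; exact ⟨n, rfl⟩
  have htop : Rmod X Set.univ = ⨆ n, satur g (n + 1) := by
    apply le_antisymm
    · intro f hf
      obtain ⟨n, rfl⟩ : f ∈ Set.range g := hg ▸ hf
      refine (le_iSup (fun n => satur g (n + 1)) n) ⟨hf, 1, one_ne_zero, ?_⟩
      rw [Int.cast_one, one_mul]
      exact Submodule.subset_span ⟨n, Nat.lt_succ_self n, rfl⟩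
    · exact iSup_le fun n f hf => hf.1
  rw [htop]
  refine chain_free _ fun n => ?_
  have hL : (⨆ j < n, satur g (j + 1)) = satur g n := by
    apply le_antisymm
    · exact iSup₂_le fun j hj => satur_mono g hj
    · cases n with
      | zero =>
        rintro f ⟨-, m, hm, h⟩
        have : f = 0 := by simpa [hm] using h
        rw [this]
        exact zero_mem _
      | succ n =>
        exact le_iSup₂_of_le (f := fun j (_ : j < n + 1) => satur g (j + 1)) n
          (Nat.lt_succ_self n) le_rfl
  rw [hL]
  have := satur_finite g hgm (n + 1)
  have htf : Module.IsTorsionFree ℤ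
      (satur g (n + 1) ⧸ (satur g n).submoduleOf (satur g (n + 1))) := by
    refine Module.IsTorsionFree.of_smul_eq_zero fun m x hmx => ?_
    obtain ⟨x, rfl⟩ := Submodule.Quotient.mk_surjective _ x
    by_cases hm : m = 0
    · exact Or.inl hm
    right
    rw [← Submodule.Quotient.mk_smul, Submodule.Quotient.mk_eq_zero] at hmx
    rw [Submodule.Quotient.mk_eq_zero]
    have hmx' : m • (x : FracField X) ∈ satur g n := hmx
    rw [zsmul_eq_mul] at hmx'
    obtain ⟨-, k, hk, h⟩ := hmx'
    refine ⟨x.2.1, k * m, mul_ne_zero hk hm, ?_⟩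
    rw [Int.cast_mul, mul_assoc]
    exact h
  refine exists_compl _ _ (satur_mono g (Nat.le_succ n))
    ((satur g n).submoduleOf (satur g (n + 1))).mkQ inferInstance ?_
  intro x
  rw [Submodule.mkQ_apply, Submodule.Quotient.mk_eq_zero]
  rfl

theorem free_Rmod (X : Type u) : Module.Free ℤ (Rmod X Set.univ) := by
  suffices h : ∀ (κ : Cardinal.{u}) (X : Type u), Cardinal.mk X = κ →
      Module.Free ℤ (Rmod X Set.univ) from h _ X rfl
  intro κ
  induction κ using WellFoundedLT.induction with
  | ind κ ih =>
    rintro X rfl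
    by_cases hX : Countable X
    · exact free_countable
    have hX' : Cardinal.aleph0 < Cardinal.mk X := by
      rwa [← Cardinal.mk_le_aleph0_iff, not_le] at hX
    obtain ⟨r, hr, hord⟩ := Cardinal.exists_ord_eq X
    classical
    let _ : LinearOrder X := linearOrderOfSTO r
    have : WellFoundedLT X := ⟨hr.wf⟩
    refine free_step hX'.le (fun x => ?_) (fun Y hY => ih _ hY Y rfl)
    have h1 : Cardinal.mk (Set.Iio x) < Cardinal.mk X := Cardinal.card_typein_lt (r := r) x hord
    have h2 : Set.Iic x = Set.Iio x ∪ {x} := by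
      ext y; simp [le_iff_lt_or_eq, or_comm]
    rw [h2]
    refine lt_of_le_of_lt (Cardinal.mk_union_le _ _) (Cardinal.add_lt_of_lt hX'.le h1 ?_)
    rw [Cardinal.mk_singleton]
    exact Cardinal.one_lt_aleph0.trans hX'

/-- For every set `X`, the additive group of the ring `R_X` is a free
abelian group, i.e. `R_X` is free as a `ℤ`-module. -/
theorem Rsub_free_additive_group (X : Type*) :
    Module.Free ℤ (Rsub X Set.univ) := by
  have h : Rsub X Set.univ = Rring X Set.univ := Subring.closure_eq (Rring X Set.univ)
  rw [h]
  have := free_Rmod X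
  let e : Rmod X Set.univ ≃+ Rring X Set.univ := AddEquiv.refl _
  exact Module.Free.of_equiv e.toIntLinearEquiv
end

section
/- Let X be a set, Y ⊆ X, n ≥ 0, and let x(1),…,x(n) ∈ X∖Y be pairwise distinct. Put W = {x(1),…,x(n)} and W(ℓ) = W∖{x(ℓ)} for ℓ = 1,…,n. Then the quotient abelian group R⁺_{W∪Y} / (Σ_{ℓ=1}^{n} R⁺_{W(ℓ)∪Y}) is free, where the sum Σ_{ℓ=1}^{n} R⁺_{W(ℓ)∪Y} is the additive subgroup of R⁺_{W∪Y} generated by the subgroups R⁺_{W(ℓ)∪Y}. -/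
set_option synthInstance.maxHeartbeats 1000000
set_option maxHeartbeats 1000000

section Helpers
open MvPolynomial

/-! ### The subfields of rational functions in the variables from `Z` -/

section FieldPart

variable {X : Type*} {A : Type*} [CommRing A] [IsDomain A]

/-- The subfield of fractions of polynomials using only variables in `Z`. -/
noncomputable def Kf (A : Type*) [CommRing A] [IsDomain A] {X : Type*} (Z : Set X) :
    Subfield (FractionRing (MvPolynomial X A)) where
  carrier := {f | ∃ p q : MvPolynomial X A, p ∈ supported A Z ∧ q ∈ supported A Z ∧ q ≠ 0 ∧
    f = algebraMap _ _ p / algebraMap _ _ q}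
  mul_mem' := by
    rintro _ _ ⟨p, q, hp, hq, hq0, rfl⟩ ⟨p', q', hp', hq', hq0', rfl⟩
    exact ⟨p * p', q * q', mul_mem hp hp', mul_mem hq hq', mul_ne_zero hq0 hq0', by
      rw [map_mul, map_mul, div_mul_div_comm]⟩
  one_mem' := ⟨1, 1, one_mem _, one_mem _, one_ne_zero, by simp⟩
  add_mem' := by
    rintro _ _ ⟨p, q, hp, hq, hq0, rfl⟩ ⟨p', q', hp', hq', hq0', rfl⟩
    refine ⟨p * q' + q * p', q * q', add_mem (mul_mem hp hq') (mul_mem hq hp'), mul_mem hq hq',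
      mul_ne_zero hq0 hq0', ?_⟩
    rw [div_add_div, map_add, map_mul, map_mul, map_mul]
    · simpa using hq0
    · simpa using hq0'
  zero_mem' := ⟨0, 1, zero_mem _, one_mem _, one_ne_zero, by simp⟩
  neg_mem' := by
    rintro _ ⟨p, q, hp, hq, hq0, rfl⟩
    exact ⟨-p, q, neg_mem hp, hq, hq0, by rw [map_neg, neg_div]⟩
  inv_mem' := by
    rintro _ ⟨p, q, hp, hq, hq0, rfl⟩
    by_cases h : p = 0
    · exact ⟨0, 1, zero_mem _, one_mem _, one_ne_zero, by simp [h]⟩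
    · exact ⟨q, p, hq, hp, h, by rw [inv_div]⟩

theorem mem_Kf {Z : Set X} {f : FractionRing (MvPolynomial X A)} :
    f ∈ Kf A Z ↔ ∃ p q : MvPolynomial X A, p ∈ supported A Z ∧ q ∈ supported A Z ∧ q ≠ 0 ∧
    f = algebraMap _ _ p / algebraMap _ _ q := Iff.rfl

theorem Kf_mono {Z Z' : Set X} (h : Z ⊆ Z') : Kf A Z ≤ Kf A Z' := by
  rintro _ ⟨p, q, hp, hq, hq0, rfl⟩
  exact ⟨p, q, supported_mono h hp, supported_mono h hq, hq0, rfl⟩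

theorem Kf_poly {Z : Set X} {p : MvPolynomial X A} (hp : p ∈ supported A Z) :
    algebraMap _ (FractionRing (MvPolynomial X A)) p ∈ Kf A Z :=
  ⟨p, 1, hp, one_mem _, one_ne_zero, by simp⟩

theorem Kf_le {Z : Set X} (L : Subfield (FractionRing (MvPolynomial X A)))
    (hC : ∀ a : A, algebraMap (MvPolynomial X A) _ (C a) ∈ L)
    (hX : ∀ z ∈ Z, algebraMap (MvPolynomial X A) _ (MvPolynomial.X z) ∈ L) : Kf A Z ≤ L := by
  have key : ∀ p ∈ supported A Z, algebraMap (MvPolynomial X A) _ p ∈ L := by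
    intro p hp
    rw [supported_eq_adjoin_X] at hp
    induction hp using Algebra.adjoin_induction with
    | mem x hx => obtain ⟨z, hz, rfl⟩ := hx; exact hX z hz
    | algebraMap r => exact hC r
    | add x y _ _ hx hy => rw [map_add]; exact add_mem hx hy
    | mul x y _ _ hx hy => rw [map_mul]; exact mul_mem hx hy
  rintro _ ⟨p, q, hp, hq, hq0, rfl⟩
  exact div_mem (key p hp) (key q hq)

theorem Kf_finite {Z : Set X} {f : FractionRing (MvPolynomial X A)} (hf : f ∈ Kf A Z) :
    ∃ T : Finset X, (T : Set X) ⊆ Z ∧ f ∈ Kf A (T : Set X) := by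
  classical
  obtain ⟨p, q, hp, hq, hq0, rfl⟩ := hf
  refine ⟨p.vars ∪ q.vars, ?_, p, q, ?_, ?_, hq0, rfl⟩
  · rw [Finset.coe_union]
    exact Set.union_subset (mem_supported.1 hp) (mem_supported.1 hq)
  · rw [mem_supported]; simp
  · rw [mem_supported]; simp

/-- The ring homomorphism of Laurent series induced by a ring homomorphism on coefficients. -/
noncomputable def laurentMap {R S : Type*} [CommRing R] [CommRing S] (f : R →+* S) :
    HahnSeries ℤ R →+* HahnSeries ℤ S where
  toFun x := x.map f
  map_one' := HahnSeries.map_one (R := R) (S := S) f.toMonoidWithZeroHom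
  map_mul' x y := HahnSeries.map_mul (f : R →ₙ+* S)
  map_zero' := by ext; simp
  map_add' x y := by ext; simp

theorem exists_laurent (y : X) : ∃ φ : FractionRing (MvPolynomial X A) →+*
      HahnSeries ℤ (FractionRing (MvPolynomial X A)),
    (∀ a : A, φ (algebraMap (MvPolynomial X A) _ (C a)) =
      HahnSeries.C (algebraMap (MvPolynomial X A) _ (C a))) ∧
    (φ (algebraMap (MvPolynomial X A) _ (MvPolynomial.X y)) = HahnSeries.single 1 1) ∧
    (∀ z, z ≠ y → φ (algebraMap (MvPolynomial X A) _ (MvPolynomial.X z)) =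
      HahnSeries.C (algebraMap (MvPolynomial X A) _ (MvPolynomial.X z))) := by
  classical
  let K := FractionRing (MvPolynomial X A)
  let ψ : MvPolynomial X A →+* Polynomial K :=
    eval₂Hom (Polynomial.C.comp ((algebraMap (MvPolynomial X A) K).comp C))
      (fun x => if x = y then Polynomial.X else
        Polynomial.C (algebraMap (MvPolynomial X A) K (MvPolynomial.X x)))
  have hψ : (Polynomial.evalRingHom (algebraMap (MvPolynomial X A) K (MvPolynomial.X y))).comp ψ =
      algebraMap (MvPolynomial X A) K := by
    apply MvPolynomial.ringHom_ext
    · intro r; simp [ψ]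
    · intro i
      by_cases h : i = y
      · simp [ψ, h]
      · simp [ψ, h]
  have hψinj : Function.Injective ψ := by
    have : Function.Injective (algebraMap (MvPolynomial X A) K) :=
      IsFractionRing.injective _ _
    rw [← hψ, RingHom.coe_comp] at this
    exact this.of_comp
  let θ : Polynomial K →+* HahnSeries ℤ K :=
    (HahnSeries.ofPowerSeries ℤ K).comp Polynomial.coeToPowerSeries.ringHom
  have hθ : Function.Injective θ := by
    apply HahnSeries.ofPowerSeries_injective.comp (Polynomial.coe_injective K)
  refine ⟨IsFractionRing.lift (g := θ.comp ψ) (hθ.comp hψinj), ?_, ?_, ?_⟩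
  · intro a
    rw [IsFractionRing.lift_algebraMap]
    simp [ψ, θ, K]
  · rw [IsFractionRing.lift_algebraMap]
    simp [ψ, θ, K]
  · intro z hz
    rw [IsFractionRing.lift_algebraMap]
    simp [ψ, θ, K, hz]

theorem exists_retraction (A : Type*) [CommRing A] [IsDomain A] (y : X) :
    ∃ ρ : FractionRing (MvPolynomial X A) →+
      FractionRing (MvPolynomial X A),
    (∀ Z : Set X, ∀ f ∈ Kf A Z, ρ f ∈ Kf A (Z \ {y})) ∧
    (∀ Z : Set X, y ∉ Z → ∀ f ∈ Kf A Z, ρ f = f) := by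
  obtain ⟨φ, h1, h2, h3⟩ := exists_laurent (A := A) y
  refine ⟨⟨⟨fun f => (φ f).coeff 0, by simp⟩, by simp⟩, ?_, ?_⟩
  · intro Z f hf
    let L := Kf A (Z \ {y})
    have : Kf A Z ≤ (laurentMap L.subtype).fieldRange.comap φ := by
      apply Kf_le
      · intro a
        refine ⟨HahnSeries.C ⟨_, Kf_poly (p := C a) ?_⟩, ?_⟩
        · exact (supported A (Z \ {y})).algebraMap_mem a
        · rw [h1]; exact HahnSeries.map_C _ _
      · intro z hz
        by_cases hzy : z = y
        · refine ⟨HahnSeries.single 1 1, ?_⟩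
          rw [hzy, h2]
          ext n
          change L.subtype ((HahnSeries.single 1 1 : HahnSeries ℤ L).coeff n) = _
          by_cases hn : n = 1
          · subst hn; simp
          · simp [hn]
        · refine ⟨HahnSeries.C ⟨_, Kf_poly (p := MvPolynomial.X z) ?_⟩, ?_⟩
          · exact X_mem_supported.2 ⟨hz, hzy⟩
          · rw [h3 z hzy]; exact HahnSeries.map_C _ _
    obtain ⟨g, hg⟩ := this hf
    change (φ f).coeff 0 ∈ _
    rw [← hg]
    exact (g.coeff 0).2
  · intro Z hy f hf
    have : Kf A Z ≤ RingHom.eqLocusField φ HahnSeries.C := by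
      apply Kf_le
      · exact h1
      · intro z hz
        exact h3 z (fun h => hy (h ▸ hz))
    have h4 : φ f = HahnSeries.C f := this hf
    change (φ f).coeff 0 = f
    rw [h4]; simp

theorem Kf_inter (S : Finset X) (Z : Set X) (T : Finset X)
    {f : FractionRing (MvPolynomial X A)} (hf : f ∈ Kf A Z)
    (g : X → FractionRing (MvPolynomial X A))
    (hg : ∀ x ∈ S, g x ∈ Kf A ((Z ∪ T) \ {x})) (hfg : f = ∑ x ∈ S, g x) :
    ∃ g' : X → FractionRing (MvPolynomial X A),
      (∀ x ∈ S, g' x ∈ Kf A (Z \ {x})) ∧ f = ∑ x ∈ S, g' x := by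
  classical
  induction T using Finset.induction_on generalizing g with
  | empty => exact ⟨g, by simpa using hg, hfg⟩
  | insert y T hy ih =>
    by_cases hyZ : y ∈ Z
    · apply ih g _ hfg
      intro x hx
      refine Kf_mono ?_ (hg x hx)
      rintro z ⟨hz, hzx⟩
      refine ⟨?_, hzx⟩
      simp only [Finset.coe_insert, Set.mem_union, Set.mem_insert_iff] at hz
      rcases hz with h | rfl | h
      · exact Or.inl h
      · exact Or.inl hyZ
      · exact Or.inr h
    · obtain ⟨ρ, h1, h2⟩ := exists_retraction A y
      apply ih (fun x => ρ (g x))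
      · intro x hx
        refine Kf_mono ?_ (h1 _ _ (hg x hx))
        rintro z ⟨⟨hz, hzx⟩, hzy⟩
        refine ⟨?_, hzx⟩
        simp only [Finset.coe_insert, Set.mem_union, Set.mem_insert_iff] at hz
        rcases hz with h | rfl | h
        · exact Or.inl h
        · exact absurd rfl hzy
        · exact Or.inr h
      · rw [← map_sum, ← hfg, h2 Z hyZ f hf]

theorem Kf_inter_univ (S : Finset X) (Z : Set X)
    {f : FractionRing (MvPolynomial X A)} (hf : f ∈ Kf A Z)
    (g : X → FractionRing (MvPolynomial X A))
    (hg : ∀ x ∈ S, g x ∈ Kf A {x}ᶜ) (hfg : f = ∑ x ∈ S, g x) :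
    ∃ g' : X → FractionRing (MvPolynomial X A),
      (∀ x ∈ S, g' x ∈ Kf A (Z \ {x})) ∧ f = ∑ x ∈ S, g' x := by
  classical
  have : ∀ x, ∃ T : Finset X, x ∈ S → (T : Set X) ⊆ {x}ᶜ ∧ g x ∈ Kf A (T : Set X) := by
    intro x
    by_cases hx : x ∈ S
    · obtain ⟨T, hT⟩ := Kf_finite (hg x hx)
      exact ⟨T, fun _ => hT⟩
    · exact ⟨∅, fun h => absurd h hx⟩
  choose T hT using this
  refine Kf_inter S Z (S.biUnion T) hf g ?_ hfg
  intro x hx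
  refine Kf_mono ?_ (hT x hx).2
  intro z hz
  refine ⟨Or.inr ?_, (hT x hx).1 hz⟩
  rw [Finset.mem_coe, Finset.mem_biUnion]
  exact ⟨x, hx, hz⟩

end FieldPart

/-! ### Filtrations with free quotients -/

section Filtration

variable {E : Type*} [AddCommGroup E]

theorem free_of_filtration_s4 {ι : Type*} [PartialOrder ι] [WellFoundedLT ι]
    (M : ι → Submodule ℤ E)
    (hinter : ∀ i, M i ⊓ (⨆ j, ⨆ (_ : ¬ i ≤ j), M j) ≤ ⨆ j, ⨆ (_ : j < i), M j)
    (hfree : ∀ i, Module.Free ℤ (M i ⧸ (⨆ j, ⨆ (_ : j < i), M j).comap (M i).subtype)) :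
    Module.Free ℤ (⨆ i, M i : Submodule ℤ E) := by
  classical
  have hC : ∀ i, ∃ C : Submodule ℤ E, Module.Free ℤ C ∧ C ≤ M i ∧
      C ⊓ (⨆ j, ⨆ (_ : j < i), M j) = ⊥ ∧ M i ≤ C ⊔ (⨆ j, ⨆ (_ : j < i), M j) := by
    intro i
    set P := ⨆ j, ⨆ (_ : j < i), M j with hP
    have := hfree i
    obtain ⟨s, hs⟩ := LinearMap.exists_rightInverse_of_surjective
      (P.comap (M i).subtype).mkQ (Submodule.range_mkQ _)
    have hs' : ∀ q, (P.comap (M i).subtype).mkQ (s q) = q := fun q => LinearMap.congr_fun hs q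
    let t := (M i).subtype ∘ₗ s
    have hsinj : Function.Injective s := Function.LeftInverse.injective hs'
    have ht : Function.Injective t := Subtype.val_injective.comp hsinj
    refine ⟨LinearMap.range t, Module.Free.of_equiv (LinearEquiv.ofInjective t ht), ?_, ?_, ?_⟩
    · rintro _ ⟨q, rfl⟩; exact (s q).2
    · rw [eq_bot_iff]
      rintro _ ⟨⟨q, rfl⟩, hq⟩
      have : (P.comap (M i).subtype).mkQ (s q) = 0 := by
        rw [Submodule.mkQ_apply, Submodule.Quotient.mk_eq_zero]; exact hq
      rw [hs'] at this
      simp [this]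
    · intro m hm
      let m' : M i := ⟨m, hm⟩
      have : m = t ((P.comap (M i).subtype).mkQ m') +
          ((m' - s ((P.comap (M i).subtype).mkQ m') : M i) : E) := by
        simp [t, m']
      rw [this]
      refine Submodule.add_mem_sup ⟨_, rfl⟩ ?_
      have h2 : (P.comap (M i).subtype).mkQ (m' - s ((P.comap (M i).subtype).mkQ m')) = 0 := by
        rw [map_sub, hs', sub_self]
      rw [Submodule.mkQ_apply, Submodule.Quotient.mk_eq_zero] at h2
      exact h2
  choose C hCf hCM hCP hCs using hC
  have hsup : ∀ i, M i ≤ ⨆ i, C i := by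
    intro i
    induction i using WellFoundedLT.induction with
    | ind i ih =>
      refine (hCs i).trans (sup_le (le_iSup C i) ?_)
      exact iSup_le fun j => iSup_le fun hj => ih j hj
  have heq : (⨆ i, M i) = ⨆ i, C i :=
    le_antisymm (iSup_le hsup) (iSup_mono hCM)
  have hinj : Function.Injective (DFinsupp.lsum ℕ fun i => (C i).subtype :
      (Π₀ i, C i) →ₗ[ℤ] E) := by
    rw [← LinearMap.ker_eq_bot, eq_bot_iff]
    intro v hv
    rw [Submodule.mem_bot]
    by_contra hne
    have hsn : v.support.Nonempty := by
      rw [Finset.nonempty_iff_ne_empty]; simpa using hne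
    obtain ⟨i, hi⟩ := v.support.exists_maximal hsn
    have h0 : ∑ j ∈ v.support, (v j : E) = 0 := by
      have : (DFinsupp.lsum ℕ fun i => (C i).subtype : (Π₀ i, C i) →ₗ[ℤ] E) v = 0 := hv
      rw [DFinsupp.lsum_apply_apply, DFinsupp.sumAddHom_apply] at this
      exact this
    rw [← Finset.add_sum_erase _ _ hi.1] at h0
    have h1 : (v i : E) ∈ ⨆ j, ⨆ (_ : ¬ i ≤ j), M j := by
      rw [eq_neg_of_add_eq_zero_left h0]
      refine neg_mem (Submodule.sum_mem _ fun j hj => ?_)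
      rw [Finset.mem_erase] at hj
      have : ¬ i ≤ j := fun h => hj.1 (le_antisymm (hi.2 hj.2 h) h)
      exact Submodule.mem_iSup_of_mem j (Submodule.mem_iSup_of_mem this (hCM j (v j).2))
    have h2 := hinter i ⟨hCM i (v i).2, h1⟩
    have h3 : (v i : E) ∈ (⊥ : Submodule ℤ E) := by
      rw [← hCP i]; exact ⟨(v i).2, h2⟩
    rw [Submodule.mem_bot] at h3
    have : i ∈ v.support := hi.1
    rw [DFinsupp.mem_support_iff] at this
    exact this (Subtype.ext h3)
  rw [heq, Submodule.iSup_eq_range_dfinsupp_lsum]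
  exact Module.Free.of_equiv (LinearEquiv.ofInjective _ hinj)

theorem mem_of_smul_mem {N M : Submodule ℤ E}
    (h : ∀ p : ℕ, p.Prime → ∀ f ∈ M, (p : ℤ) • f ∈ N → f ∈ N) (m : ℕ) (hm : m ≠ 0) :
    ∀ f ∈ M, (m : ℤ) • f ∈ N → f ∈ N := by
  induction m using Nat.recOnMul with
  | zero => exact absurd rfl hm
  | one => intro f _ hf; simpa using hf
  | prime p hp => exact h p hp
  | mul a b ha hb =>
    intro f hf hab
    refine hb (by rintro rfl; simp at hm) f hf (ha (by rintro rfl; simp at hm) _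
      (M.smul_mem _ hf) ?_)
    rw [smul_smul]; exact_mod_cast hab

theorem free_quotient_of_pure {N M : Submodule ℤ E} (hM : Module.Finite ℤ M)
    (h : ∀ p : ℕ, p.Prime → ∀ f ∈ M, (p : ℤ) • f ∈ N → f ∈ N) :
    Module.Free ℤ (M ⧸ N.comap M.subtype) := by
  have : Module.IsTorsionFree ℤ (M ⧸ N.comap M.subtype) := by
    constructor
    intro r hr
    rw [isSMulRegular_iff_right_eq_zero_of_smul]
    intro q hq
    obtain ⟨f, rfl⟩ := Submodule.mkQ_surjective _ q
    rw [← map_smul] at hq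
    rw [Submodule.mkQ_apply, Submodule.Quotient.mk_eq_zero] at hq ⊢
    have hr0 : r ≠ 0 := hr.ne_zero
    refine mem_of_smul_mem h r.natAbs (by simpa using hr0) f f.2 ?_
    have hq' : r • (f : E) ∈ N := hq
    rcases Int.natAbs_eq r with h | h
    · rw [← h]; exact hq'
    · rw [h, neg_smul] at hq'
      exact neg_mem_iff.1 hq'
  infer_instance

end Filtration

section SubFree

theorem free_submodule_finsupp {ι : Type*} (N : Submodule ℤ (ι →₀ ℤ)) : Module.Free ℤ N := by
  classical
  let _ : LinearOrder ι := linearOrderOfSTO (WellOrderingRel (α := ι))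
  have _ : WellFoundedLT ι := inferInstanceAs (IsWellFounded ι WellOrderingRel)
  let M : ι → Submodule ℤ (ι →₀ ℤ) := fun i => N ⊓ Finsupp.supported ℤ ℤ (Set.Iic i)
  have hmax : ∀ f ∈ N, f ≠ 0 → ∃ j ∈ f.support, f ∈ M j := by
    intro f hf h0
    have hne : f.support.Nonempty := Finsupp.support_nonempty_iff.2 h0
    refine ⟨f.support.max' hne, Finset.max'_mem _ _, hf, ?_⟩
    refine (Finsupp.mem_supported _ _).2 ?_
    intro k hk
    exact Finset.le_max' _ _ hk
  have hsup : (⨆ i, M i) = N := by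
    refine le_antisymm (iSup_le fun i => inf_le_left) fun f hf => ?_
    by_cases h0 : f = 0
    · rw [h0]; exact zero_mem _
    · obtain ⟨j, -, hj⟩ := hmax f hf h0
      exact Submodule.mem_iSup_of_mem j hj
  have hfr : Module.Free ℤ (⨆ i, M i : Submodule ℤ (ι →₀ ℤ)) := by
    apply free_of_filtration_s4
    · intro i
      simp only [not_le]
      exact inf_le_right
    · intro i
      have hlt : ∀ f, f ∈ (⨆ j, ⨆ (_ : j < i), M j) → f i = 0 := by
        have : (⨆ j, ⨆ (_ : j < i), M j) ≤ LinearMap.ker (Finsupp.lapply (R := ℤ) (M := ℤ) i) := by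
          refine iSup₂_le fun j hj f hf => ?_
          rw [LinearMap.mem_ker, Finsupp.lapply_apply]
          by_contra h
          have := (Finsupp.mem_supported _ _).1 hf.2 (Finsupp.mem_support_iff.2 h)
          exact absurd (lt_of_le_of_lt this hj) (lt_irrefl _)
        exact fun f hf => this hf
      let φ : M i →ₗ[ℤ] ℤ := (Finsupp.lapply (R := ℤ) (M := ℤ) i).comp (M i).subtype
      have hker : (⨆ j, ⨆ (_ : j < i), M j).comap (M i).subtype = LinearMap.ker φ := by
        ext f
        rw [LinearMap.mem_ker]
        constructor
        · intro hf
          exact hlt _ hf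
        · intro hf
          have hf' : (f : ι →₀ ℤ) i = 0 := hf
          rw [Submodule.mem_comap]
          change (f : ι →₀ ℤ) ∈ _
          by_cases h0 : (f : ι →₀ ℤ) = 0
          · rw [h0]; exact zero_mem _
          · obtain ⟨j, hj1, hj2⟩ := hmax f f.2.1 h0
            have hji : j ≤ i := (Finsupp.mem_supported _ _).1 f.2.2 hj1
            have hne : j ≠ i := by
              rintro rfl
              exact (Finsupp.mem_support_iff.1 hj1) hf'
            exact Submodule.mem_iSup_of_mem j
              (Submodule.mem_iSup_of_mem (lt_of_le_of_ne hji hne) hj2)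
      rw [hker]
      exact Module.Free.of_equiv φ.quotKerEquivRange.symm
  rwa [hsup] at hfr

theorem free_of_injective_s4 {A B : Type*} [AddCommGroup A] [AddCommGroup B] [Module.Free ℤ B]
    (f : A →+ B) (hf : Function.Injective f) : Module.Free ℤ A := by
  let b := (Module.Free.chooseBasis ℤ B).repr
  let g : A →ₗ[ℤ] (Module.Free.ChooseBasisIndex ℤ B →₀ ℤ) := b.toLinearMap.comp f.toIntLinearMap
  have hg : Function.Injective g := b.injective.comp hf
  have := free_submodule_finsupp (LinearMap.range g)
  exact Module.Free.of_equiv (LinearEquiv.ofInjective g hg).symm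

/-- If `φ` is additive on `A` with kernel `K` and values in a free group then `A ⧸ K` is free. -/
theorem free_quotient_of_ker {A B : Type*} [AddCommGroup A] [AddCommGroup B] [Module.Free ℤ B]
    (f : A →+ B) (K : AddSubgroup A) (hK : ∀ a, a ∈ K ↔ f a = 0) : Module.Free ℤ (A ⧸ K) := by
  have : K = f.ker := by ext a; rw [hK, AddMonoidHom.mem_ker]
  subst this
  exact free_of_injective_s4 (QuotientAddGroup.kerLift f) (QuotientAddGroup.kerLift_injective f)

end SubFree

/-! ### Primitive polynomials and the groups `R_Z` -/

section RPart

variable {X : Type*}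

theorem mvPrimitive_iff (q : MvPolynomial X ℤ) :
    MvPrimitive q ↔ ∀ p : ℕ, p.Prime → MvPolynomial.map (Int.castRingHom (ZMod p)) q ≠ 0 := by
  constructor
  · intro h p hp h0
    refine h p (by exact_mod_cast hp.one_lt) ?_
    exact (C_dvd_iff_zmod p q).2 h0
  · intro h m hm hd
    have hm' : m.natAbs ≠ 1 := by omega
    obtain ⟨p, hp, hpm⟩ := Nat.exists_prime_and_dvd hm'
    refine h p hp ((C_dvd_iff_zmod p q).1 (dvd_trans ?_ hd))
    exact map_dvd C (Int.natCast_dvd.2 hpm)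

theorem MvPrimitive.mul {q q' : MvPolynomial X ℤ} (h : MvPrimitive q) (h' : MvPrimitive q') :
    MvPrimitive (q * q') := by
  rw [mvPrimitive_iff] at *
  intro p hp
  have := Fact.mk hp
  rw [map_mul]
  exact mul_ne_zero (h p hp) (h' p hp)

theorem MvPrimitive.of_coeff_one {q : MvPolynomial X ℤ} (m : X →₀ ℕ) (h : q.coeff m = 1) :
    MvPrimitive q := by
  intro k hk hd
  rw [C_dvd_iff_dvd_coeff] at hd
  have := hd m
  rw [h] at this
  have := Int.le_of_dvd one_pos this
  omega

theorem mvPrimitive_one : MvPrimitive (1 : MvPolynomial X ℤ) :=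
  MvPrimitive.of_coeff_one 0 (by simp)

theorem MvPrimitive.ne_zero {q : MvPolynomial X ℤ} (h : MvPrimitive q) : q ≠ 0 := by
  rintro rfl
  exact h 2 (by norm_num) (dvd_zero _)

theorem MvPrimitive.algebraMap_ne_zero {q : MvPolynomial X ℤ} (h : MvPrimitive q) :
    algebraMap (MvPolynomial X ℤ) (FracField X) q ≠ 0 := by
  simpa using h.ne_zero

/-- The submodule version of `R_Z`. -/
noncomputable def RS {X : Type*} (Z : Set X) : Submodule ℤ (FracField X) :=
  AddSubgroup.toIntSubmodule
  { carrier := Rset X Z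
    zero_mem' := ⟨0, 1, zero_mem _, one_mem _, mvPrimitive_one, by simp⟩
    neg_mem' := by
      rintro _ ⟨p, q, hp, hq, hq0, rfl⟩
      exact ⟨-p, q, neg_mem hp, hq, hq0, by rw [map_neg, neg_div]⟩
    add_mem' := by
      rintro _ _ ⟨p, q, hp, hq, hq0, rfl⟩ ⟨p', q', hp', hq', hq0', rfl⟩
      refine ⟨p * q' + q * p', q * q', add_mem (mul_mem hp hq') (mul_mem hq hp'), mul_mem hq hq',
        hq0.mul hq0', ?_⟩
      rw [div_add_div _ _ hq0.algebraMap_ne_zero hq0'.algebraMap_ne_zero,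
        map_add, map_mul, map_mul, map_mul] }

theorem mem_RS {Z : Set X} {f : FracField X} : f ∈ RS Z ↔ f ∈ Rset X Z := Iff.rfl

theorem Radd_eq (Z : Set X) : Radd X Z = (RS Z).toAddSubgroup :=
  le_antisymm ((AddSubgroup.closure_le _).2 fun _ h => h) AddSubgroup.subset_closure

theorem RS_mono {Z Z' : Set X} (h : Z ⊆ Z') : RS Z ≤ RS Z' := by
  rintro _ ⟨p, q, hp, hq, hq0, rfl⟩
  exact ⟨p, q, supported_mono h hp, supported_mono h hq, hq0, rfl⟩

theorem RS_le_Kf {Z : Set X} {f : FracField X} (hf : f ∈ RS Z) : f ∈ Kf ℤ Z := by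
  obtain ⟨p, q, hp, hq, hq0, rfl⟩ := hf
  exact ⟨p, q, hp, hq, hq0.ne_zero, rfl⟩

theorem RS_finite {Z : Set X} {f : FracField X} (hf : f ∈ RS Z) :
    ∃ T : Finset X, (T : Set X) ⊆ Z ∧ f ∈ RS (T : Set X) := by
  classical
  obtain ⟨p, q, hp, hq, hq0, rfl⟩ := hf
  refine ⟨p.vars ∪ q.vars, ?_, p, q, ?_, ?_, hq0, rfl⟩
  · rw [Finset.coe_union]
    exact Set.union_subset (mem_supported.1 hp) (mem_supported.1 hq)
  · rw [mem_supported]; simp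
  · rw [mem_supported]; simp

theorem supported_of_support_subset {A B : Type*} [CommRing A] [CommRing B] {Z : Set X}
    {p : MvPolynomial X A} {q : MvPolynomial X B} (h : p.support ⊆ q.support)
    (hq : q ∈ supported B Z) : p ∈ supported A Z := by
  rw [mem_supported] at *
  intro z hz
  apply hq
  rw [Finset.mem_coe, mem_vars_iff_mem_support] at *
  obtain ⟨d, hd, hz⟩ := hz
  exact ⟨d, h hd, hz⟩

theorem supported_of_C_mul {Z : Set X} {p : MvPolynomial X ℤ} {m : ℤ} (hm : m ≠ 0)
    (h : C m * p ∈ supported ℤ Z) : p ∈ supported ℤ Z := by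
  refine supported_of_support_subset (fun d hd => ?_) h
  rw [mem_support_iff] at *
  rw [coeff_C_mul]
  exact mul_ne_zero hm hd

theorem exists_primitive {Z : Set X} (q : MvPolynomial X ℤ) (hq : q ∈ supported ℤ Z) (h0 : q ≠ 0) :
    ∃ (m : ℤ) (q' : MvPolynomial X ℤ), m ≠ 0 ∧ q' ∈ supported ℤ Z ∧ MvPrimitive q' ∧
      q = C m * q' := by
  obtain ⟨d, hd⟩ := MvPolynomial.ne_zero_iff.1 h0
  induction hn : (q.coeff d).natAbs using Nat.strong_induction_on generalizing q with
  | _ n ih =>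
    by_cases hp : MvPrimitive q
    · exact ⟨1, q, one_ne_zero, hq, hp, by simp⟩
    · unfold MvPrimitive at hp
      push Not at hp
      obtain ⟨m, hm, q1, rfl⟩ := hp
      rw [coeff_C_mul] at hd hn
      have hq1 := supported_of_C_mul (by omega) hq
      have hd1 : q1.coeff d ≠ 0 := right_ne_zero_of_mul hd
      have hlt : (q1.coeff d).natAbs < n := by
        rw [← hn, Int.natAbs_mul]
        have : 0 < (q1.coeff d).natAbs := Int.natAbs_pos.2 hd1
        have : 1 < m.natAbs := by omega
        nlinarith
      obtain ⟨k, q', hk, hq', hpq', rfl⟩ := ih _ hlt q1 hq1 (right_ne_zero_of_mul h0) hd1 rfl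
      exact ⟨m * k, q', mul_ne_zero (by omega) hk, hq', hpq', by rw [C_mul, mul_assoc]⟩

theorem algebraMap_C_int (m : ℤ) :
    algebraMap (MvPolynomial X ℤ) (FracField X) (C m) = (m : FracField X) := by
  have : (C m : MvPolynomial X ℤ) = (m : MvPolynomial X ℤ) := by simp
  rw [this, map_intCast]

theorem exists_smul_mem_RS {Z : Set X} {f : FracField X} (hf : f ∈ Kf ℤ Z) :
    ∃ m : ℕ, m ≠ 0 ∧ (m : ℤ) • f ∈ RS Z := by
  obtain ⟨p, q, hp, hq, hq0, rfl⟩ := hf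
  obtain ⟨m, q', hm, hq', hpq', rfl⟩ := exists_primitive q hq hq0
  have hm' : (m : FracField X) ≠ 0 := by
    rw [← algebraMap_C_int]; simpa using hm
  have : m • (algebraMap (MvPolynomial X ℤ) (FracField X) p /
      algebraMap (MvPolynomial X ℤ) (FracField X) (C m * q')) ∈ RS Z := by
    refine ⟨p, q', hp, hq', hpq', ?_⟩
    have := hpq'.algebraMap_ne_zero
    rw [map_mul, algebraMap_C_int, zsmul_eq_mul]
    field_simp
  refine ⟨m.natAbs, by simpa using hm, ?_⟩
  rcases Int.natAbs_eq m with h | h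
  · rw [← h]; exact this
  · have h2 : (m.natAbs : ℤ) = -m := by omega
    rw [h2, neg_smul]
    exact neg_mem this

/-! ### Reduction modulo a prime -/

/-- The multiplicative set of primitive polynomials. -/
def primSub (X : Type*) : Submonoid (MvPolynomial X ℤ) where
  carrier := {q | MvPrimitive q}
  one_mem' := mvPrimitive_one
  mul_mem' := MvPrimitive.mul

theorem exists_red (X : Type*) (p : ℕ) (hp : p.Prime) [IsDomain (ZMod p)] :
    ∃ red : RS (Set.univ : Set X) →+ FractionRing (MvPolynomial X (ZMod p)),
      ∀ (a q : MvPolynomial X ℤ) (_ : MvPrimitive q) (f : RS (Set.univ : Set X)),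
        (f : FracField X) = algebraMap _ _ a / algebraMap _ _ q →
        red f = algebraMap _ _ (MvPolynomial.map (Int.castRingHom (ZMod p)) a) /
          algebraMap _ _ (MvPolynomial.map (Int.castRingHom (ZMod p)) q) := by
  let S := primSub X
  have hS : S ≤ nonZeroDivisors (MvPolynomial X ℤ) := fun q hq =>
    mem_nonZeroDivisors_of_ne_zero (MvPrimitive.ne_zero hq)
  let L := Localization S
  let g : MvPolynomial X ℤ →+* FractionRing (MvPolynomial X (ZMod p)) :=
    (algebraMap _ _).comp (MvPolynomial.map (Int.castRingHom (ZMod p)))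
  have hg : ∀ q : MvPolynomial X ℤ, MvPrimitive q → g q ≠ 0 := by
    intro q hq
    simpa [g] using (mvPrimitive_iff q).1 hq p hp
  have hgu : ∀ y : S, IsUnit (g y) := fun y => (hg y y.2).isUnit
  let r : L →+* FractionRing (MvPolynomial X (ZMod p)) := IsLocalization.lift (M := S) hgu
  have hiu : ∀ y : S, IsUnit (algebraMap (MvPolynomial X ℤ) (FracField X) y) :=
    fun y => (MvPrimitive.algebraMap_ne_zero y.2).isUnit
  let i : L →+* FracField X := IsLocalization.lift (M := S) hiu
  have hi : Function.Injective i := by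
    rw [IsLocalization.lift_injective_iff]
    intro x y
    rw [(IsLocalization.injective L hS).eq_iff,
      (IsFractionRing.injective (MvPolynomial X ℤ) (FracField X)).eq_iff]
  have key : ∀ (a q : MvPolynomial X ℤ) (hq : MvPrimitive q),
      i (IsLocalization.mk' L a (⟨q, hq⟩ : S)) = algebraMap _ _ a / algebraMap _ _ q := by
    intro a q hq
    rw [IsLocalization.lift_mk'_spec, mul_div_cancel₀ _ hq.algebraMap_ne_zero]
  have key2 : ∀ (a q : MvPolynomial X ℤ) (hq : MvPrimitive q),
      r (IsLocalization.mk' L a (⟨q, hq⟩ : S)) = g a / g q := by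
    intro a q hq
    rw [IsLocalization.lift_mk'_spec, mul_div_cancel₀ _ (hg q hq)]
  have hsurj : ∀ f : RS (Set.univ : Set X), ∃ l : L, i l = f := by
    rintro ⟨_, a, q, -, -, hq, rfl⟩
    exact ⟨_, key a q hq⟩
  choose s hs using hsurj
  refine ⟨⟨⟨fun f => r (s f), ?_⟩, ?_⟩, ?_⟩
  · have : s 0 = 0 := hi (by rw [hs]; simp)
    rw [this, map_zero]
  · intro f f'
    have : s (f + f') = s f + s f' := hi (by rw [hs, map_add, hs, hs]; rfl)
    change r (s (f + f')) = r (s f) + r (s f')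
    rw [this, map_add]
  · intro a q hq f hf
    have : s f = IsLocalization.mk' L a (⟨q, hq⟩ : S) := hi (by rw [hs, key, hf])
    change r (s f) = _
    rw [this, key2]
    rfl

end RPart

section RedPart

variable {X : Type*}

theorem exists_red' (X : Type*) (p : ℕ) (hp : p.Prime) [IsDomain (ZMod p)] :
    ∃ red : FracField X → FractionRing (MvPolynomial X (ZMod p)),
      (∀ (a q : MvPolynomial X ℤ) (_ : MvPrimitive q),
        red (algebraMap _ _ a / algebraMap _ _ q) =
          algebraMap _ _ (MvPolynomial.map (Int.castRingHom (ZMod p)) a) /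
          algebraMap _ _ (MvPolynomial.map (Int.castRingHom (ZMod p)) q)) ∧
      (∀ f ∈ RS (Set.univ : Set X), ∀ g ∈ RS (Set.univ : Set X), red (f - g) = red f - red g) ∧
      (∀ (S : Finset X) (g : X → FracField X), (∀ x ∈ S, g x ∈ RS (Set.univ : Set X)) →
        red (∑ x ∈ S, g x) = ∑ x ∈ S, red (g x)) ∧
      (∀ f ∈ RS (Set.univ : Set X), red ((p : ℤ) • f) = 0) := by
  classical
  obtain ⟨r, hr⟩ := exists_red X p hp
  let red : FracField X → FractionRing (MvPolynomial X (ZMod p)) :=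
    fun f => if h : f ∈ RS (Set.univ : Set X) then r ⟨f, h⟩ else 0
  have hred : ∀ f (h : f ∈ RS (Set.univ : Set X)), red f = r ⟨f, h⟩ := fun f h => dif_pos h
  refine ⟨red, ?_, ?_, ?_, ?_⟩
  · intro a q hq
    have : algebraMap (MvPolynomial X ℤ) (FracField X) a / algebraMap _ _ q ∈
        RS (Set.univ : Set X) := ⟨a, q, by simp [supported_univ], by simp [supported_univ], hq, rfl⟩
    rw [hred _ this]
    exact hr a q hq _ rfl
  · intro f hf g hg
    rw [hred _ hf, hred _ hg, hred _ (sub_mem hf hg), ← map_sub]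
    rfl
  · intro S g hg
    induction S using Finset.induction_on with
    | empty =>
      rw [Finset.sum_empty, Finset.sum_empty, hred _ (zero_mem _)]
      exact map_zero r
    | insert x S hx ih =>
      have h1 := hg x (Finset.mem_insert_self _ _)
      have h2 : ∀ x ∈ S, g x ∈ RS (Set.univ : Set X) :=
        fun y hy => hg y (Finset.mem_insert_of_mem hy)
      rw [Finset.sum_insert hx, Finset.sum_insert hx, ← ih h2, hred _ h1,
        hred _ (sum_mem h2), hred _ (add_mem h1 (sum_mem h2)), ← map_add]
      rfl
  · intro f hf
    rw [hred _ (Submodule.smul_mem _ _ hf)]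
    have : (⟨(p : ℤ) • f, Submodule.smul_mem _ _ hf⟩ : RS (Set.univ : Set X)) =
        (p : ℤ) • ⟨f, hf⟩ := rfl
    rw [this, map_zsmul, zsmul_eq_mul]
    have h0 : ((p : ℤ) : FractionRing (MvPolynomial X (ZMod p))) = 0 := by
      have : ((p : ℤ) : FractionRing (MvPolynomial X (ZMod p))) =
          algebraMap (MvPolynomial X (ZMod p)) _ (C ((p : ℕ) : ZMod p)) := by
        simp
      rw [this, ZMod.natCast_self, C_0, map_zero]
    rw [h0, zero_mul]

/-- A chosen reduction map modulo `p`. -/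
noncomputable def red (p : ℕ) [hp : Fact p.Prime] :
    FracField X → FractionRing (MvPolynomial X (ZMod p)) :=
  (exists_red' X p hp.out).choose

theorem red_div (p : ℕ) [hp : Fact p.Prime] (a q : MvPolynomial X ℤ) (hq : MvPrimitive q) :
    red p (algebraMap (MvPolynomial X ℤ) (FracField X) a /
      algebraMap (MvPolynomial X ℤ) (FracField X) q) =
      algebraMap (MvPolynomial X (ZMod p)) (FractionRing (MvPolynomial X (ZMod p))) (MvPolynomial.map (Int.castRingHom (ZMod p)) a) /
      algebraMap (MvPolynomial X (ZMod p)) (FractionRing (MvPolynomial X (ZMod p))) (MvPolynomial.map (Int.castRingHom (ZMod p)) q) :=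
  (exists_red' X p hp.out).choose_spec.1 a q hq

theorem red_sub (p : ℕ) [hp : Fact p.Prime] {f g : FracField X}
    (hf : f ∈ RS (Set.univ : Set X)) (hg : g ∈ RS (Set.univ : Set X)) :
    red p (f - g) = red p f - red p g := (exists_red' X p hp.out).choose_spec.2.1 f hf g hg

theorem red_sum (p : ℕ) [hp : Fact p.Prime] (S : Finset X) (g : X → FracField X)
    (hg : ∀ x ∈ S, g x ∈ RS (Set.univ : Set X)) :
    red p (∑ x ∈ S, g x) = ∑ x ∈ S, red p (g x) := (exists_red' X p hp.out).choose_spec.2.2.1 S g hg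

theorem red_smul (p : ℕ) [hp : Fact p.Prime] {f : FracField X}
    (hf : f ∈ RS (Set.univ : Set X)) : red p ((p : ℤ) • f) = 0 := (exists_red' X p hp.out).choose_spec.2.2.2 f hf

theorem RS_univ {Z : Set X} {f : FracField X} (hf : f ∈ RS Z) : f ∈ RS (Set.univ : Set X) :=
  RS_mono (Set.subset_univ _) hf

theorem map_supported (p : ℕ) {Z : Set X} {a : MvPolynomial X ℤ} (ha : a ∈ supported ℤ Z) :
    MvPolynomial.map (Int.castRingHom (ZMod p)) a ∈ supported (ZMod p) Z :=
  supported_of_support_subset (support_map_subset _ _) ha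

theorem red_mem (p : ℕ) [hp : Fact p.Prime] {Z : Set X} {f : FracField X} (hf : f ∈ RS Z) :
    red p f ∈ Kf (ZMod p) Z := by
  obtain ⟨a, q, ha, hq, hqp, rfl⟩ := hf
  rw [red_div p a q hqp]
  exact ⟨_, _, map_supported p ha, map_supported p hq, (mvPrimitive_iff q).1 hqp p hp.out, rfl⟩

theorem exists_lift (p : ℕ) [hp : Fact p.Prime] {Z : Set X} {a : MvPolynomial X (ZMod p)}
    (ha : a ∈ supported (ZMod p) Z) :
    ∃ b ∈ supported ℤ Z, MvPolynomial.map (Int.castRingHom (ZMod p)) b = a ∧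
      ∀ d, a.coeff d = 1 → b.coeff d = 1 := by
  classical
  let b : MvPolynomial X ℤ := ∑ d ∈ a.support, monomial d ((a.coeff d).val : ℤ)
  have hb : ∀ d, b.coeff d = ((a.coeff d).val : ℤ) := by
    intro d
    simp only [b, coeff_sum, coeff_monomial]
    rw [Finset.sum_ite_eq' a.support d]
    split_ifs with h
    · rfl
    · rw [notMem_support_iff.1 h]; simp
  refine ⟨b, supported_of_support_subset (fun d hd => ?_) ha, ?_, ?_⟩
  · rw [mem_support_iff] at *
    rw [hb] at hd
    intro h
    rw [h] at hd
    simp at hd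
  · ext d
    rw [coeff_map, hb]
    simp
  · intro d hd
    have : Fact (1 < p) := ⟨hp.out.one_lt⟩
    rw [hb, hd, ZMod.val_one]
    rfl

theorem red_surj (p : ℕ) [hp : Fact p.Prime] {Z : Set X}
    {h : FractionRing (MvPolynomial X (ZMod p))} (hh : h ∈ Kf (ZMod p) Z) :
    ∃ f ∈ RS Z, red p f = h := by
  obtain ⟨a, q, ha, hq, hq0, rfl⟩ := hh
  obtain ⟨d, hd⟩ := MvPolynomial.ne_zero_iff.1 hq0
  have hu : (q.coeff d)⁻¹ ≠ 0 := inv_ne_zero hd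
  set u := (q.coeff d)⁻¹ with hu'
  have hC : (C u : MvPolynomial X (ZMod p)) ∈ supported (ZMod p) Z :=
    (supported (ZMod p) Z).algebraMap_mem u
  obtain ⟨a', ha', haa, -⟩ := exists_lift p (mul_mem hC ha)
  obtain ⟨q', hq', hqq, h1⟩ := exists_lift p (mul_mem hC hq)
  have hprim : MvPrimitive q' := MvPrimitive.of_coeff_one d (h1 d (by
    rw [coeff_C_mul, hu', inv_mul_cancel₀ hd]))
  refine ⟨_, ⟨a', q', ha', hq', hprim, rfl⟩, ?_⟩
  rw [red_div p a' q' hprim, haa, hqq, map_mul, map_mul, mul_div_mul_left]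
  simpa using hu

theorem red_eq_zero (p : ℕ) [hp : Fact p.Prime] {a q : MvPolynomial X ℤ} (hq : MvPrimitive q)
    (h : red p (algebraMap (MvPolynomial X ℤ) (FracField X) a /
      algebraMap (MvPolynomial X ℤ) (FracField X) q) = 0) : C (p : ℤ) ∣ a := by
  rw [red_div p a q hq, div_eq_zero_iff] at h
  rw [C_dvd_iff_zmod]
  rcases h with h | h
  · simpa using h
  · exact absurd (by simpa using h) ((mvPrimitive_iff q).1 hq p hp.out)

theorem exists_of_red_eq_zero (p : ℕ) [hp : Fact p.Prime] {Z : Set X} {f : FracField X}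
    (hf : f ∈ RS Z) (h : red p f = 0) : ∃ g ∈ RS Z, f = (p : ℤ) • g := by
  obtain ⟨a, q, ha, hq, hqp, rfl⟩ := hf
  obtain ⟨b, rfl⟩ := red_eq_zero p hqp h
  refine ⟨_, ⟨b, q, supported_of_C_mul (by exact_mod_cast hp.out.ne_zero) ha, hq, hqp, rfl⟩, ?_⟩
  rw [map_mul, algebraMap_C_int, zsmul_eq_mul, mul_div_assoc]

theorem smul_inj {m : ℤ} (hm : m ≠ 0) {f g : FracField X} (h : m • f = m • g) : f = g := by
  have hm' : (m : FracField X) ≠ 0 := by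
    rw [← algebraMap_C_int]; simpa using hm
  rw [zsmul_eq_mul, zsmul_eq_mul] at h
  exact mul_left_cancel₀ hm' h

/-- The group `∑_{x ∈ S} R_{Z \ {x}}` is pure in `R_Z`. -/
theorem RS_pure (p : ℕ) [hp : Fact p.Prime] (Z : Set X) (S : Finset X) (f : FracField X)
    (hf : f ∈ RS Z) (g : X → FracField X) (hg : ∀ x ∈ S, g x ∈ RS (Z \ {x}))
    (hfg : (p : ℤ) • f = ∑ x ∈ S, g x) :
    ∃ g' : X → FracField X, (∀ x ∈ S, g' x ∈ RS (Z \ {x})) ∧ f = ∑ x ∈ S, g' x := by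
  classical
  have hp0 : (p : ℤ) ≠ 0 := by exact_mod_cast hp.out.ne_zero
  induction S using Finset.induction_on generalizing f g with
  | empty =>
    refine ⟨0, by simp, ?_⟩
    apply smul_inj hp0
    rw [hfg]; simp
  | insert y S hy ih =>
    rw [Finset.sum_insert hy] at hfg
    have h1 := hg y (Finset.mem_insert_self _ _)
    have h2 : ∀ x ∈ S, g x ∈ RS (Z \ {x}) := fun x hx => hg x (Finset.mem_insert_of_mem hx)
    have hred : red p (g y) = ∑ x ∈ S, - red p (g x) := by
      have : g y = (p : ℤ) • f - ∑ x ∈ S, g x := by rw [hfg]; abel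
      rw [this, red_sub p (Submodule.smul_mem _ _ (RS_univ hf))
        (sum_mem fun x hx => RS_univ (h2 x hx)), red_smul p (RS_univ hf), zero_sub,
        red_sum p S g (fun x hx => RS_univ (h2 x hx)), Finset.sum_neg_distrib]
    obtain ⟨h, hh, hsum⟩ := Kf_inter S (Z \ {y}) {y} (red_mem p h1) _ (fun x hx => by
      refine neg_mem (Kf_mono ?_ (red_mem p (h2 x hx)))
      rintro z ⟨hz, hzx⟩
      refine ⟨?_, hzx⟩
      by_cases hzy : z = y
      · right; simp [hzy]
      · left; exact ⟨hz, hzy⟩) hred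
    have : ∀ x, ∃ k : FracField X, x ∈ S → k ∈ RS ((Z \ {y}) \ {x}) ∧ red p k = h x := by
      intro x
      by_cases hx : x ∈ S
      · obtain ⟨k, hk⟩ := red_surj p (hh x hx)
        exact ⟨k, fun _ => hk⟩
      · exact ⟨0, fun h => absurd h hx⟩
    choose k hk using this
    have hk1 : ∀ x ∈ S, k x ∈ RS (Z \ {y}) := fun x hx =>
      RS_mono Set.sdiff_subset (hk x hx).1
    have hk2 : ∀ x ∈ S, k x ∈ RS (Z \ {x}) := fun x hx =>
      RS_mono (Set.sdiff_subset_sdiff_left Set.sdiff_subset) (hk x hx).1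
    have h3 : red p (g y - ∑ x ∈ S, k x) = 0 := by
      rw [red_sub p (RS_univ h1) (sum_mem fun x hx => RS_univ (hk1 x hx)),
        red_sum p S k (fun x hx => RS_univ (hk1 x hx)), hsum, sub_eq_zero]
      exact Finset.sum_congr rfl fun x hx => ((hk x hx).2).symm
    obtain ⟨e, he, hge⟩ := exists_of_red_eq_zero p (sub_mem h1 (sum_mem hk1)) h3
    obtain ⟨g', hg', hfg'⟩ := ih (f - e) (sub_mem hf (RS_mono Set.sdiff_subset he))
      (fun x => g x + k x) (fun x hx => add_mem (h2 x hx) (hk2 x hx)) (by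
        rw [zsmul_sub, hfg, ← hge, Finset.sum_add_distrib]; abel)
    refine ⟨Function.update g' y e, ?_, ?_⟩
    · intro x hx
      by_cases hxy : x = y
      · subst hxy; simpa using he
      · rw [Function.update_of_ne hxy]
        exact hg' x (Finset.mem_of_mem_insert_of_ne hx hxy)
    · rw [Finset.sum_insert hy, Function.update_self]
      have : ∑ x ∈ S, Function.update g' y e x = ∑ x ∈ S, g' x :=
        Finset.sum_congr rfl fun x hx => Function.update_of_ne
          (show x ≠ y by rintro rfl; exact hy hx) _ _
      rw [this, ← hfg']; abel

/-- The intersection lemma. -/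
theorem RS_inter (Z : Set X) (S : Finset X) (f : FracField X)
    (hf : f ∈ RS Z) (g : X → FracField X) (hg : ∀ x ∈ S, g x ∈ RS {x}ᶜ)
    (hfg : f = ∑ x ∈ S, g x) :
    ∃ g' : X → FracField X, (∀ x ∈ S, g' x ∈ RS (Z \ {x})) ∧ f = ∑ x ∈ S, g' x := by
  classical
  obtain ⟨u, hu, hfu⟩ := Kf_inter_univ S Z (RS_le_Kf hf) g (fun x hx => RS_le_Kf (hg x hx)) hfg
  have : ∀ x, ∃ m : ℕ, m ≠ 0 ∧ (x ∈ S → (m : ℤ) • u x ∈ RS (Z \ {x})) := by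
    intro x
    by_cases hx : x ∈ S
    · obtain ⟨m, hm, h⟩ := exists_smul_mem_RS (hu x hx)
      exact ⟨m, hm, fun _ => h⟩
    · exact ⟨1, one_ne_zero, fun h => absurd h hx⟩
  choose m hm hmu using this
  let H : Submodule ℤ (FracField X) := ⨆ x ∈ S, RS (Z \ {x})
  have hHmem : ∀ f, f ∈ H ↔ ∃ g' : X → FracField X, (∀ x ∈ S, g' x ∈ RS (Z \ {x})) ∧
      f = ∑ x ∈ S, g' x := by
    intro f
    constructor
    · intro h
      obtain ⟨μ, hμ⟩ := (Submodule.mem_iSup_finset_iff_exists_sum _ _).1 h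
      exact ⟨fun x => μ x, fun x _ => (μ x).2, hμ.symm⟩
    · rintro ⟨g', hg', rfl⟩
      exact sum_mem fun x hx => Submodule.mem_iSup_of_mem x (Submodule.mem_iSup_of_mem hx (hg' x hx))
  rw [← hHmem]
  refine mem_of_smul_mem (N := H) (M := RS Z) ?_ (∏ x ∈ S, m x)
    (Finset.prod_ne_zero_iff.2 fun x _ => hm x) f hf ?_
  · intro p hp f hf hpf
    have := Fact.mk hp
    rw [hHmem] at hpf ⊢
    obtain ⟨g', hg', h⟩ := hpf
    exact RS_pure p Z S f hf g' hg' h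
  · rw [hHmem]
    refine ⟨fun x => ((∏ x ∈ S, m x : ℕ) : ℤ) • u x, ?_, ?_⟩
    · intro x hx
      change ((∏ x ∈ S, m x : ℕ) : ℤ) • u x ∈ _
      rw [← Finset.mul_prod_erase S m hx, mul_comm, Nat.cast_mul, mul_smul]
      exact Submodule.smul_mem _ _ (hmu x hx)
    · simp only [zsmul_eq_mul]
      rw [← Finset.mul_sum, ← hfu]

end RedPart

section PhiPart

variable {X V : Type*}

/-- The map of function fields induced by an injection of variables. -/
noncomputable def phi (e : X ↪ V) : FracField X →+* FracField V :=
  IsFractionRing.map (A := MvPolynomial X ℤ) (B := MvPolynomial V ℤ)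
    (j := (rename e : MvPolynomial X ℤ →ₐ[ℤ] MvPolynomial V ℤ).toRingHom)
    (rename_injective e e.injective)

theorem phi_algebraMap (e : X ↪ V) (a : MvPolynomial X ℤ) :
    phi e (algebraMap (MvPolynomial X ℤ) (FracField X) a) =
      algebraMap (MvPolynomial V ℤ) (FracField V) (rename e a) :=
  IsLocalization.map_eq (M := nonZeroDivisors (MvPolynomial X ℤ))
    (T := nonZeroDivisors (MvPolynomial V ℤ))
    (nonZeroDivisors_le_comap_nonZeroDivisors_of_injective _
      (rename_injective e e.injective)) a

theorem phi_div (e : X ↪ V) (a q : MvPolynomial X ℤ) :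
    phi e (algebraMap (MvPolynomial X ℤ) (FracField X) a /
        algebraMap (MvPolynomial X ℤ) (FracField X) q) =
      algebraMap (MvPolynomial V ℤ) (FracField V) (rename e a) /
        algebraMap (MvPolynomial V ℤ) (FracField V) (rename e q) := by
  rw [map_div₀, phi_algebraMap, phi_algebraMap]

theorem phi_injective (e : X ↪ V) : Function.Injective (phi e) := (phi e).injective

theorem mvPrimitive_rename (e : X ↪ V) {q : MvPolynomial X ℤ} :
    MvPrimitive (rename e q) ↔ MvPrimitive q := by
  constructor
  · intro h m hm hd
    apply h m hm
    have := map_dvd (rename e : MvPolynomial X ℤ →ₐ[ℤ] MvPolynomial V ℤ) hd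
    rwa [rename_C] at this
  · intro h m hm hd
    apply h m hm
    have := map_dvd (killCompl (R := ℤ) e.injective) hd
    rwa [killCompl_C, killCompl_rename_app] at this

theorem rename_mem_supported (e : X ↪ V) {Z : Set X} {a : MvPolynomial X ℤ}
    (ha : a ∈ supported ℤ Z) : rename e a ∈ supported ℤ (e '' Z) := by
  rw [mem_supported] at *
  intro v hv
  obtain ⟨x, hx, rfl⟩ := mem_vars_rename e a hv
  exact ⟨x, ha hx, rfl⟩

theorem exists_rename_of_supported (e : X ↪ V) {Z : Set X} {b : MvPolynomial V ℤ}
    (hb : b ∈ supported ℤ (e '' Z)) : ∃ a ∈ supported ℤ Z, rename e a = b := by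
  rw [supported_eq_adjoin_X, ← Set.image_comp] at hb
  have : ((fun i => (MvPolynomial.X i : MvPolynomial V ℤ)) ∘ e) '' Z =
      (rename e : MvPolynomial X ℤ →ₐ[ℤ] MvPolynomial V ℤ) '' (MvPolynomial.X '' Z) := by
    rw [← Set.image_comp]
    refine Set.image_congr fun x _ => ?_
    simp
  have hb' : b ∈ Algebra.adjoin ℤ ((rename e : MvPolynomial X ℤ →ₐ[ℤ] MvPolynomial V ℤ) ''
    (MvPolynomial.X '' Z)) := by rw [← this]; exact hb
  rw [← AlgHom.map_adjoin] at hb'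
  obtain ⟨a, ha, h⟩ := hb'
  refine ⟨a, ?_, h⟩
  rw [supported_eq_adjoin_X]
  exact ha

theorem phi_mem (e : X ↪ V) {Z : Set X} {f : FracField X} (hf : f ∈ RS Z) :
    phi e f ∈ RS (e '' Z) := by
  obtain ⟨a, q, ha, hq, hqp, rfl⟩ := hf
  exact ⟨_, _, rename_mem_supported e ha, rename_mem_supported e hq,
    (mvPrimitive_rename e).2 hqp, phi_div e a q⟩

theorem phi_surj (e : X ↪ V) {Z : Set X} {g : FracField V} (hg : g ∈ RS (e '' Z)) :
    ∃ f ∈ RS Z, phi e f = g := by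
  obtain ⟨a, q, ha, hq, hqp, rfl⟩ := hg
  obtain ⟨a, ha', rfl⟩ := exists_rename_of_supported e ha
  obtain ⟨q, hq', rfl⟩ := exists_rename_of_supported e hq
  exact ⟨_, ⟨a, q, ha', hq', (mvPrimitive_rename e).1 hqp, rfl⟩, phi_div e a q⟩

theorem phi_congr (e e' : X ↪ V) {Z : Set X} (h : ∀ x ∈ Z, e x = e' x) {f : FracField X}
    (hf : f ∈ RS Z) : phi e f = phi e' f := by
  have key : ∀ a ∈ supported ℤ Z, rename e a = rename e' a := by
    intro a ha
    rw [mem_supported] at ha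
    refine hom_congr_vars (f₁ := (rename e : MvPolynomial X ℤ →ₐ[ℤ] MvPolynomial V ℤ).toRingHom)
      (f₂ := (rename e' : MvPolynomial X ℤ →ₐ[ℤ] MvPolynomial V ℤ).toRingHom) ?_ ?_ rfl
    · ext1 m
      simp
    · intro i hi _
      simp [h i (ha hi)]
  obtain ⟨a, q, ha, hq, hqp, rfl⟩ := hf
  rw [phi_div, phi_div, key a ha, key q hq]

end PhiPart

section FinPart

variable {F : Type*}

/-- `P ↦ P / Q` as a linear map. -/
noncomputable def divMap (Q : MvPolynomial F ℤ) : MvPolynomial F ℤ →ₗ[ℤ] FracField F :=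
  ((AddMonoidHom.mulRight (algebraMap (MvPolynomial F ℤ) (FracField F) Q)⁻¹).comp
    (algebraMap (MvPolynomial F ℤ) (FracField F)).toAddMonoidHom).toIntLinearMap

theorem divMap_apply (Q P : MvPolynomial F ℤ) :
    divMap Q P = algebraMap (MvPolynomial F ℤ) (FracField F) P /
      algebraMap (MvPolynomial F ℤ) (FracField F) Q := by
  rw [div_eq_mul_inv]
  rfl

theorem totalDegree_of_C_mul {m : ℤ} (hm : m ≠ 0) (P : MvPolynomial F ℤ) :
    P.totalDegree ≤ (C m * P).totalDegree := by
  apply totalDegree_le_of_support_subset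
  intro d hd
  rw [mem_support_iff] at *
  rw [coeff_C_mul]
  exact mul_ne_zero hm hd

theorem free_RS_univ_of_finite [Finite F] : Module.Free ℤ (RS (Set.univ : Set F)) := by
  classical
  have : Countable (MvPolynomial F ℤ) := by
    rw [← Cardinal.mk_le_aleph0_iff]
    refine cardinalMk_le_max_lift.trans ?_
    simp
  have : Nonempty {q : MvPolynomial F ℤ // MvPrimitive q} := ⟨⟨1, mvPrimitive_one⟩⟩
  obtain ⟨q', hq'⟩ := exists_surjective_nat {q : MvPolynomial F ℤ // MvPrimitive q}
  let q : ℕ → MvPolynomial F ℤ := fun k => q' k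
  have hq : ∀ k, MvPrimitive (q k) := fun k => (q' k).2
  let Q : ℕ → MvPolynomial F ℤ := fun k => ∏ i ∈ Finset.range k, q i
  have hQ : ∀ k, MvPrimitive (Q k) := by
    intro k
    induction k with
    | zero => simpa [Q] using mvPrimitive_one
    | succ k ih =>
      simp only [Q, Finset.prod_range_succ]
      exact ih.mul (hq k)
  let d : ℕ → ℕ := fun k => k + ∑ i ∈ Finset.range k, (q i).totalDegree
  let M : ℕ → Submodule ℤ (FracField F) := fun k =>
    (restrictTotalDegree F ℤ (d k)).map (divMap (Q k))
  have hM : ∀ k f, f ∈ M k ↔ ∃ P : MvPolynomial F ℤ, P.totalDegree ≤ d k ∧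
      f = algebraMap (MvPolynomial F ℤ) (FracField F) P /
      algebraMap (MvPolynomial F ℤ) (FracField F) (Q k) := by
    intro k f
    simp only [M, Submodule.mem_map, mem_restrictTotalDegree, divMap_apply]
    constructor
    · rintro ⟨P, h, rfl⟩; exact ⟨P, h, rfl⟩
    · rintro ⟨P, h, rfl⟩; exact ⟨P, h, rfl⟩
  have hMR : ∀ k, M k ≤ RS (Set.univ : Set F) := by
    intro k f hf
    obtain ⟨P, h, rfl⟩ := (hM k f).1 hf
    exact ⟨P, Q k, by simp [supported_univ], by simp [supported_univ], hQ k, rfl⟩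
  have hmono : Monotone M := by
    refine monotone_nat_of_le_succ fun k f hf => ?_
    obtain ⟨P, h, rfl⟩ := (hM k f).1 hf
    refine (hM (k + 1) _).2 ⟨P * q k, ?_, ?_⟩
    · refine (totalDegree_mul _ _).trans ?_
      simp only [d, Finset.sum_range_succ] at h ⊢
      omega
    · have : Q (k + 1) = Q k * q k := Finset.prod_range_succ _ _
      rw [this, map_mul, map_mul, mul_div_mul_right _ _ (hq k).algebraMap_ne_zero]
  have hsup : (⨆ k, M k) = RS (Set.univ : Set F) := by
    refine le_antisymm (iSup_le hMR) ?_
    rintro _ ⟨P, s, -, -, hs, rfl⟩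
    obtain ⟨i, hi⟩ := hq' ⟨s, hs⟩
    have hi' : q i = s := congrArg Subtype.val hi
    let k := max P.totalDegree (i + 1)
    have hik : i ∈ Finset.range k := by simp [k]
    refine Submodule.mem_iSup_of_mem k ((hM k _).2
      ⟨P * ∏ j ∈ (Finset.range k).erase i, q j, ?_, ?_⟩)
    · refine (totalDegree_mul _ _).trans (add_le_add (le_max_left _ _) ?_)
      refine (totalDegree_finsetProd _ _).trans ?_
      exact Finset.sum_le_sum_of_subset (Finset.erase_subset _ _)
    · have h1 : Q k = s * ∏ j ∈ (Finset.range k).erase i, q j := by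
        rw [← hi']
        exact (Finset.mul_prod_erase _ _ hik).symm
      have h2 : algebraMap (MvPolynomial F ℤ) (FracField F)
          (∏ j ∈ (Finset.range k).erase i, q j) ≠ 0 := by
        simp only [ne_eq, FaithfulSMul.algebraMap_eq_zero_iff]
        exact Finset.prod_ne_zero_iff.2 fun j _ => (hq j).ne_zero
      rw [h1, map_mul, map_mul, mul_div_mul_right _ _ h2]
  rw [← hsup]
  apply free_of_filtration_s4
  · intro i
    simp only [not_le]
    exact inf_le_right
  · intro i
    have hfin : Module.Finite ℤ (M i) := Module.Finite.map _ _
    refine free_quotient_of_pure hfin ?_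
    intro p hp f hf hpf
    have hp0 : (p : ℤ) ≠ 0 := by exact_mod_cast hp.ne_zero
    cases i with
    | zero =>
      simp only [not_lt_zero, iSup_false, iSup_bot, Submodule.mem_bot] at hpf ⊢
      apply smul_inj hp0
      rw [hpf, zsmul_zero]
    | succ k =>
      have hN : (⨆ j, ⨆ (_ : j < k + 1), M j) = M k := by
        refine le_antisymm (iSup₂_le fun j hj => hmono (Nat.lt_succ_iff.1 hj)) ?_
        exact le_iSup₂_of_le k (Nat.lt_succ_self k) le_rfl
      rw [hN] at hpf ⊢
      obtain ⟨P, hP, h⟩ := (hM k _).1 hpf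
      have := Fact.mk hp
      have h0 : red p ((p : ℤ) • f) = 0 := red_smul p (hMR _ hf)
      rw [h] at h0
      obtain ⟨P', rfl⟩ := red_eq_zero p (hQ k) h0
      refine (hM k _).2 ⟨P', (totalDegree_of_C_mul hp0 P').trans hP, ?_⟩
      apply smul_inj hp0
      rw [h, map_mul, algebraMap_C_int, zsmul_eq_mul, mul_div_assoc]

theorem free_RS_of_finite {X : Type*} (T : Finset X) : Module.Free ℤ (RS (T : Set X)) := by
  let e : (T : Set X) ↪ X := Function.Embedding.subtype _
  have h1 : e '' Set.univ = (T : Set X) := by simp [e]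
  have hfree : Module.Free ℤ (RS (Set.univ : Set (T : Set X))) := free_RS_univ_of_finite
  have : ∀ g : RS (T : Set X), ∃ f : RS (Set.univ : Set (T : Set X)), phi e f = (g : FracField X) := by
    intro g
    obtain ⟨f, hf, h⟩ := phi_surj e (Z := Set.univ) (g := g) (by rw [h1]; exact g.2)
    exact ⟨⟨f, hf⟩, h⟩
  choose r hr using this
  let ρ : RS (T : Set X) →+ RS (Set.univ : Set (T : Set X)) := AddMonoidHom.mk' r (by
    intro a b
    apply Subtype.ext
    apply phi_injective e
    rw [hr, Submodule.coe_add, Submodule.coe_add, map_add, hr, hr])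
  refine free_of_injective_s4 ρ fun a b hab => ?_
  have : r a = r b := hab
  apply Subtype.ext
  rw [← hr a, ← hr b, this]

end FinPart

section Doubling

variable {X : Type*}

open Classical in
/-- The injection `X → X ⊕ X` using the second copy of the variables in `S`. -/
noncomputable def dbl (S : Finset X) : X ↪ X ⊕ X where
  toFun x := if x ∈ S then Sum.inr x else Sum.inl x
  inj' := by
    intro a b h
    simp only at h
    split_ifs at h <;> simpa using h

theorem dbl_mem {S : Finset X} {x : X} (h : x ∈ S) : dbl S x = Sum.inr x := by
  classical
  exact if_pos h

theorem dbl_notMem {S : Finset X} {x : X} (h : x ∉ S) : dbl S x = Sum.inl x := by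
  classical
  exact if_neg h

theorem RS_sign {V : Type*} {Z : Set V} {f : FracField V} (hf : f ∈ RS Z) (k : ℕ) :
    (-1) ^ k * f ∈ RS Z := by
  rcases neg_one_pow_eq_or (FracField V) k with h | h
  · rwa [h, one_mul]
  · rw [h, neg_one_mul]; exact neg_mem hf

/-- The alternating sum over all partial doublings of the variables in `W`. -/
noncomputable def Dmap (W : Finset X) : FracField X →+ FracField (X ⊕ X) :=
  AddMonoidHom.mk' (fun f => ∑ S ∈ W.powerset, (-1) ^ S.card * phi (dbl S) f) (by
    intro a b
    simp only [map_add, mul_add, Finset.sum_add_distrib])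

theorem Dmap_apply (W : Finset X) (f : FracField X) :
    Dmap W f = ∑ S ∈ W.powerset, (-1) ^ S.card * phi (dbl S) f := rfl

theorem Dmap_eq_zero (W : Finset X) {x : X} (hx : x ∈ W) {Z : Set X} (hxZ : x ∉ Z)
    {f : FracField X} (hf : f ∈ RS Z) : Dmap W f = 0 := by
  classical
  rw [Dmap_apply, ← Finset.insert_erase hx, Finset.sum_powerset_insert (Finset.notMem_erase _ _),
    ← Finset.sum_add_distrib]
  refine Finset.sum_eq_zero fun S hS => ?_
  have hxS : x ∉ S := fun h => Finset.notMem_erase x W (Finset.mem_powerset.1 hS h)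
  have h : phi (dbl (insert x S)) f = phi (dbl S) f := by
    refine phi_congr _ _ (fun y hy => ?_) hf
    have hyx : y ≠ x := by rintro rfl; exact hxZ hy
    by_cases hyS : y ∈ S
    · rw [dbl_mem hyS, dbl_mem (Finset.mem_insert_of_mem hyS)]
    · rw [dbl_notMem hyS, dbl_notMem (by simp [hyx, hyS])]
  rw [h, Finset.card_insert_of_notMem hxS, pow_succ]
  ring

theorem Dmap_mem (W : Finset X) {Z : Set X} {f : FracField X} (hf : f ∈ RS Z) :
    Dmap W f ∈ RS (Sum.inl '' Z ∪ Sum.inr '' Z) := by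
  rw [Dmap_apply]
  refine sum_mem fun S _ => RS_sign (RS_mono ?_ (phi_mem (dbl S) hf)) _
  rintro _ ⟨y, hy, rfl⟩
  by_cases h : y ∈ S
  · rw [dbl_mem h]; exact Or.inr ⟨y, hy, rfl⟩
  · rw [dbl_notMem h]; exact Or.inl ⟨y, hy, rfl⟩

theorem Dmap_ker (W : Finset X) {Z : Set X} {f : FracField X} (hf : f ∈ RS Z)
    (h : Dmap W f = 0) :
    ∃ g : X → FracField X, (∀ x ∈ W, g x ∈ RS (Z \ {x})) ∧ f = ∑ x ∈ W, g x := by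
  classical
  let e : X ↪ X ⊕ X := dbl ∅
  have he : ∀ x, e x = Sum.inl x := fun x => dbl_notMem (Finset.notMem_empty x)
  rw [Dmap_apply, ← Finset.add_sum_erase _ _ (Finset.empty_mem_powerset W),
    Finset.card_empty, pow_zero, one_mul] at h
  have hH : phi e f ∈ (⨆ v ∈ W.map e, RS ({v}ᶜ : Set (X ⊕ X))) := by
    rw [eq_neg_of_add_eq_zero_left h]
    refine neg_mem (sum_mem fun S hS => ?_)
    rw [Finset.mem_erase, Finset.mem_powerset] at hS
    obtain ⟨x, hx⟩ := Finset.nonempty_iff_ne_empty.2 hS.1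
    refine Submodule.mem_iSup_of_mem (e x) (Submodule.mem_iSup_of_mem
      (Finset.mem_map_of_mem e (hS.2 hx)) (RS_sign (RS_mono ?_ (phi_mem (dbl S) hf)) _))
    rintro _ ⟨y, hy, rfl⟩ hyx
    rw [Set.mem_singleton_iff, he] at hyx
    by_cases hyS : y ∈ S
    · rw [dbl_mem hyS] at hyx; cases hyx
    · rw [dbl_notMem hyS] at hyx
      cases hyx
      exact hyS hx
  obtain ⟨μ, hμ⟩ := (Submodule.mem_iSup_finset_iff_exists_sum _ _).1 hH
  obtain ⟨g, hg, hfg⟩ := RS_inter (e '' Z) (W.map e) (phi e f) (phi_mem e hf)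
    (fun v => μ v) (fun v _ => (μ v).2) hμ.symm
  have : ∀ x, ∃ k : FracField X, x ∈ W → k ∈ RS (Z \ {x}) ∧ phi e k = g (e x) := by
    intro x
    by_cases hx : x ∈ W
    · have h1 := hg (e x) (Finset.mem_map_of_mem e hx)
      rw [← Set.image_singleton, ← Set.image_sdiff e.injective] at h1
      obtain ⟨k, hk⟩ := phi_surj e h1
      exact ⟨k, fun _ => hk⟩
    · exact ⟨0, fun h => absurd h hx⟩
  choose k hk using this
  refine ⟨k, fun x hx => (hk x hx).1, ?_⟩
  apply phi_injective e
  rw [hfg, map_sum, Finset.sum_map]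
  exact Finset.sum_congr rfl fun x hx => ((hk x hx).2).symm

theorem free_RS_univ (X : Type*) : Module.Free ℤ (RS (Set.univ : Set X)) := by
  classical
  let M : Finset X → Submodule ℤ (FracField X) := fun T => RS (T : Set X)
  have hsup : (⨆ T, M T) = RS (Set.univ : Set X) := by
    refine le_antisymm (iSup_le fun T => RS_mono (Set.subset_univ _)) fun f hf => ?_
    obtain ⟨T, -, hT⟩ := RS_finite hf
    exact Submodule.mem_iSup_of_mem T hT
  have hsum : ∀ (T : Finset X) (g : X → FracField X),
      (∀ x ∈ T, g x ∈ RS ((T : Set X) \ {x})) →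
      ∑ x ∈ T, g x ∈ ⨆ j, ⨆ (_ : j < T), M j := by
    intro T g hg
    refine sum_mem fun x hx => Submodule.mem_iSup_of_mem (T.erase x)
      (Submodule.mem_iSup_of_mem (Finset.erase_ssubset hx) ?_)
    have := hg x hx
    rwa [← Finset.coe_erase] at this
  rw [← hsup]
  apply free_of_filtration_s4
  · rintro T f ⟨hf, hf'⟩
    have hle : (⨆ j, ⨆ (_ : ¬ T ≤ j), M j) ≤ ⨆ x ∈ T, RS ({x}ᶜ : Set X) := by
      refine iSup₂_le fun j hj => ?_
      obtain ⟨x, hx, hxj⟩ := Finset.not_subset.1 hj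
      refine le_iSup₂_of_le x hx (RS_mono ?_)
      rintro y hy rfl
      exact hxj hy
    obtain ⟨μ, hμ⟩ := (Submodule.mem_iSup_finset_iff_exists_sum _ _).1 (hle hf')
    have hf1 : f ∈ RS (T : Set X) := hf
    obtain ⟨g, hg, hfg⟩ := RS_inter (T : Set X) T f hf1
      (fun v => (μ v : FracField X)) (fun v _ => (μ v).2) hμ.symm
    rw [hfg]
    exact hsum T g hg
  · intro T
    have hfr := free_RS_of_finite (T.disjSum T)
    let D : M T →+ RS ((T.disjSum T : Finset (X ⊕ X)) : Set (X ⊕ X)) :=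
      AddMonoidHom.mk' (fun f => ⟨Dmap T f, RS_mono (by
        rintro _ (⟨y, hy, rfl⟩ | ⟨y, hy, rfl⟩)
        · simpa using hy
        · simpa using hy) (Dmap_mem T f.2)⟩) (by
        intro a b
        apply Subtype.ext
        exact map_add (Dmap T) _ _)
    have hD : ∀ f, D f = 0 ↔ Dmap T f = 0 := fun f => Subtype.ext_iff
    have hker : (⨆ j, ⨆ (_ : j < T), M j).comap (M T).subtype =
        LinearMap.ker D.toIntLinearMap := by
      ext f
      rw [LinearMap.mem_ker, AddMonoidHom.coe_toIntLinearMap, hD, Submodule.mem_comap]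
      change (f : FracField X) ∈ _ ↔ _
      constructor
      · intro hf
        have : (⨆ j, ⨆ (_ : j < T), M j) ≤ LinearMap.ker (Dmap T).toIntLinearMap := by
          refine iSup₂_le fun j hj g hg => ?_
          obtain ⟨x, hx, hxj⟩ := Finset.exists_of_ssubset hj
          exact Dmap_eq_zero T hx (by exact_mod_cast hxj) hg
        exact this hf
      · intro hf
        obtain ⟨g, hg, hfg⟩ := Dmap_ker T f.2 hf
        rw [hfg]
        exact hsum T g hg
    rw [hker]
    have := free_of_injective_s4 (LinearMap.range D.toIntLinearMap).subtype.toAddMonoidHom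
      (Submodule.subtype_injective _)
    exact Module.Free.of_equiv D.toIntLinearMap.quotKerEquivRange.symm

end Doubling

end Helpers

/-- Let `Y ⊆ X`, `n ≥ 0`, and `x 1, …, x n ∈ X \ Y` pairwise distinct;
put `W = {x 1, …, x n}` and `W(ℓ) = W \ {x ℓ}`.  Then the quotient abelian group
`R⁺_{W ∪ Y} / (Σ_{ℓ} R⁺_{W(ℓ) ∪ Y})` is free, where the sum is the additive subgroup
generated by the subgroups `R⁺_{W(ℓ) ∪ Y}`. -/
theorem quotient_free {X : Type*} (Y : Set X) (n : ℕ) (x : Fin n → X)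
    (hinj : Function.Injective x) (hxY : ∀ i, x i ∉ Y) :
    Module.Free ℤ
      ((Radd X (Set.range x ∪ Y)) ⧸
        ((⨆ ℓ : Fin n, Radd X ((Set.range x \ {x ℓ}) ∪ Y)).addSubgroupOf
          (Radd X (Set.range x ∪ Y)))) := by
  classical
  have hfr := free_RS_univ (X ⊕ X)
  have hR : ∀ (Z : Set X) (f : FracField X), f ∈ Radd X Z ↔ f ∈ RS Z := by
    intro Z f; rw [Radd_eq]; rfl
  let W : Finset X := Finset.univ.image x
  let D : Radd X (Set.range x ∪ Y) →+ RS (Set.univ : Set (X ⊕ X)) :=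
    AddMonoidHom.mk' (fun f => ⟨Dmap W f, RS_mono (Set.subset_univ _)
      (Dmap_mem W ((hR _ _).1 f.2))⟩) (by
      intro a b
      apply Subtype.ext
      exact map_add (Dmap W) _ _)
  have hD : ∀ f, D f = 0 ↔ Dmap W f = 0 := fun f => Subtype.ext_iff
  refine free_quotient_of_ker D _ fun f => ?_
  rw [AddSubgroup.mem_addSubgroupOf, hD]
  constructor
  · intro hf
    have : (⨆ ℓ : Fin n, Radd X ((Set.range x \ {x ℓ}) ∪ Y)) ≤ (Dmap W).ker := by
      refine iSup_le fun ℓ g hg => ?_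
      refine Dmap_eq_zero W (x := x ℓ) (by simp [W]) (Z := (Set.range x \ {x ℓ}) ∪ Y) ?_
        ((hR _ _).1 hg)
      rintro (h | h)
      · exact h.2 rfl
      · exact hxY ℓ h
    exact this hf
  · intro hf
    obtain ⟨g, hg, hfg⟩ := Dmap_ker W ((hR _ _).1 f.2) hf
    rw [hfg]
    refine sum_mem fun y hy => ?_
    obtain ⟨ℓ, -, rfl⟩ := Finset.mem_image.1 hy
    refine AddSubgroup.mem_iSup_of_mem ℓ ((hR _ _).2 (RS_mono ?_ (hg _ hy)))
    rintro z ⟨hz | hz, hzx⟩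
    · exact Or.inl ⟨hz, hzx⟩
    · exact Or.inr hz
end
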